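/- arXiv:1509.05783 — 3 statements merged into one kernel-verified Lean document; each statement's English description precedes it below -/
import Mathlib

section
/- (Brascamp–Lieb) Let m ≥ n, let u_1, …, u_m ∈ ℝⁿ and c_1, …, c_m > 0 with c_1 + ⋯ + c_m = n, and set F = inf{ det(Σ_{j=1}^m c_j λ_j u_j ⊗ u_j) / Π_{j=1}^m λ_j^{c_j} : λ_1, …, λ_m > 0 }. Then for all integrable functions f_1, …, f_m : ℝ → [0,∞) one has √F · ∫_{ℝⁿ} Π_{j=1}^m f_j^{c_j}(⟨x, u_j⟩) dx ≤ Π_{j=1}^m (∫_ℝ f_j)^{c_j}. -/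
open MeasureTheory
open scoped Matrix

open Filter Topology Set in
lemma exists_cumulative {p : ℝ → ℝ} (hp : Continuous p) (hpos : ∀ t, 0 < p t)
    (hpi : Integrable p) :
    ∃ P : ℝ → ℝ, StrictMono P ∧ (∀ t, HasStrictDerivAt P (p t) t) ∧
      range P = Ioo 0 (∫ t, p t) := by
  set P : ℝ → ℝ := fun t => ∫ x in Iic t, p x with hP
  have hd : ∀ t, HasStrictDerivAt P (p t) t := by
    intro t
    have h1 : P = fun u => (∫ x in (0:ℝ)..u, p x) + P 0 := by
      funext u
      have := intervalIntegral.integral_Iic_sub_Iic (μ := volume) (f := p) (a := 0) (b := u)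
        hpi.integrableOn hpi.integrableOn
      simp only [hP]; linarith
    rw [h1]
    exact (intervalIntegral.integral_hasStrictDerivAt_right hpi.intervalIntegrable
      hp.stronglyMeasurable.stronglyMeasurableAtFilter hp.continuousAt).add_const _
  have hmono : StrictMono P := strictMono_of_deriv_pos fun t => by
    rw [(hd t).hasDerivAt.deriv]; exact hpos t
  have hcont : Continuous P := continuous_iff_continuousAt.2 fun t => (hd t).hasDerivAt.continuousAt
  have hbot : Tendsto P atBot (𝓝 0) := tendsto_integral_Iic_zero tendsto_id
  have htop : Tendsto P atTop (𝓝 (∫ t, p t)) :=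
    (aecover_Iic tendsto_id).integral_tendsto_of_countably_generated hpi
  refine ⟨P, hmono, hd, Subset.antisymm ?_ ?_⟩
  · rintro _ ⟨t, rfl⟩
    exact ⟨(hmono.monotone.le_of_tendsto hbot (t - 1)).trans_lt (hmono (by linarith)),
      (hmono (show t < t + 1 by linarith)).trans_le (hmono.monotone.ge_of_tendsto htop (t + 1))⟩
  · rintro y ⟨h0, h1⟩
    exact mem_range_of_exists_le_of_exists_ge hcont
      ((hbot.eventually (gt_mem_nhds h0)).exists.imp fun _ h => h.le)
      ((htop.eventually (lt_mem_nhds h1)).exists.imp fun _ h => h.le)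

open Filter Topology Set in
lemma exists_transport {p q : ℝ → ℝ} (hp : Continuous p) (hppos : ∀ t, 0 < p t)
    (hpint : Integrable p) (hq : Continuous q) (hqpos : ∀ t, 0 < q t) (hqint : Integrable q)
    (hpq : ∫ t, p t = ∫ t, q t) :
    ∃ T : ℝ → ℝ, StrictMono T ∧ ∀ t, HasDerivAt T (p t / q (T t)) t := by
  obtain ⟨P, hPm, hPd, hPr⟩ := exists_cumulative hp hppos hpint
  obtain ⟨Q, hQm, hQd, hQr⟩ := exists_cumulative hq hqpos hqint
  have hr : range P = range Q := by rw [hPr, hQr, hpq]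
  have hex : ∀ t, ∃ s, Q s = P t := fun t => by
    have : P t ∈ range Q := hr ▸ mem_range_self t
    exact this
  choose T hT using hex
  have hTm : StrictMono T := fun s t hst => hQm.lt_iff_lt.1 (by rw [hT, hT]; exact hPm hst)
  have hTs : Function.Surjective T := fun t => by
    obtain ⟨s, hs⟩ : Q t ∈ range P := hr ▸ mem_range_self t
    exact ⟨s, hQm.injective (by rw [hT, hs])⟩
  have hTc : Continuous T := hTm.monotone.continuous_of_surjective hTs
  refine ⟨T, hTm, fun t => ?_⟩
  have hl := (hQd (T t)).to_localInverse (hqpos _).ne'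
  have hev := ((hQd (T t)).hasStrictFDerivAt_equiv (hqpos _).ne').eventually_left_inverse
  rw [hT t] at hl
  have := hl.hasDerivAt.comp t (hPd t).hasDerivAt
  rw [div_eq_inv_mul]
  refine this.congr_of_eventuallyEq ?_
  filter_upwards [hTc.continuousAt.eventually hev] with s hs
  rw [hT s] at hs
  exact hs.symm

open Filter Topology in
lemma exists_seq_continuous_pos {f : ℝ → ℝ} (hf0 : ∀ t, 0 ≤ f t) (hf : Integrable f) :
    ∃ g : ℕ → ℝ → ℝ, (∀ k, Continuous (g k)) ∧ (∀ k t, 0 < g k t) ∧ (∀ k, Integrable (g k)) ∧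
      (∀ᵐ t, Tendsto (fun k => g k t) atTop (𝓝 (f t))) ∧
      Tendsto (fun k => ∫ t, g k t) atTop (𝓝 (∫ t, f t)) := by
  have hE : Integrable (fun t : ℝ => Real.exp (-1 * t ^ 2)) := integrable_exp_neg_mul_sq one_pos
  have hEc : Continuous (fun t : ℝ => Real.exp (-1 * t ^ 2)) := by fun_prop
  set δ : ℕ → ℝ := fun k => 1 / ((k : ℝ) + 1) with hδ
  have hδpos : ∀ k, 0 < δ k := fun k => by positivity
  have hδ0 : Tendsto δ atTop (𝓝 0) := tendsto_one_div_add_atTop_nhds_zero_nat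
  have H : ∀ k : ℕ, ∃ g : ℝ → ℝ, HasCompactSupport g ∧ ∫ x, ‖f x - g x‖ ≤ δ k ∧
      Continuous g ∧ Integrable g := fun k => hf.exists_hasCompactSupport_integral_sub_le (hδpos k)
  choose g _ hg hgc hgi using H
  let h : ℕ → ℝ → ℝ := fun k t => |g k t| + δ k * Real.exp (-1 * t ^ 2)
  have hhi : ∀ k, Integrable (h k) := fun k => (hgi k).abs.add (hE.const_mul _)
  have hhc : ∀ k, Continuous (h k) := fun k => (hgc k).abs.add (hEc.const_mul _)
  have hhp : ∀ k t, 0 < h k t := fun k t => by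
    have := hδpos k
    positivity
  have hb : ∀ k, ∫ t, ‖h k t - f t‖ ≤ δ k + δ k * ∫ t : ℝ, Real.exp (-1 * t ^ 2) := fun k => by
    calc ∫ t, ‖h k t - f t‖ ≤ ∫ t, (‖f t - g k t‖ + δ k * Real.exp (-1 * t ^ 2)) := by
          refine integral_mono ((hhi k).sub hf).norm ((hf.sub (hgi k)).norm.add (hE.const_mul _)) ?_
          intro t
          have h1 : |(|g k t| - |f t|)| ≤ |g k t - f t| := abs_abs_sub_abs_le _ _
          rw [abs_of_nonneg (hf0 t), abs_sub_comm (g k t)] at h1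
          have h2 : 0 < δ k * Real.exp (-1 * t ^ 2) := mul_pos (hδpos k) (Real.exp_pos _)
          simp only [h, Real.norm_eq_abs]
          calc _ = |(|g k t| - f t) + δ k * Real.exp (-1 * t ^ 2)| := by ring_nf
            _ ≤ _ := (abs_add_le _ _).trans (by rw [abs_of_pos h2]; linarith)
      _ = (∫ t, ‖f t - g k t‖) + δ k * ∫ t : ℝ, Real.exp (-1 * t ^ 2) := by
          rw [← integral_const_mul]; exact integral_add (hf.sub (hgi k)).norm (hE.const_mul _)
      _ ≤ _ := by linarith [hg k]
  have hL1 : Tendsto (fun k => ∫ t, ‖h k t - f t‖) atTop (𝓝 0) :=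
    squeeze_zero (fun k => integral_nonneg fun t => norm_nonneg _) hb
      (by simpa only [zero_mul, add_zero] using
        hδ0.add (hδ0.mul_const (∫ t : ℝ, Real.exp (-1 * t ^ 2))))
  have heL : Tendsto (fun k => eLpNorm (h k - f) 1 volume) atTop (𝓝 0) := by
    have := ENNReal.tendsto_ofReal hL1
    rw [ENNReal.ofReal_zero] at this
    refine this.congr fun k => ?_
    rw [eLpNorm_one_eq_lintegral_enorm]
    exact ofReal_integral_norm_eq_lintegral_enorm ((hhi k).sub hf)
  obtain ⟨ns, hns, hae⟩ := (tendstoInMeasure_of_tendsto_eLpNorm one_ne_zero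
    (fun k => (hhi k).aestronglyMeasurable) hf.aestronglyMeasurable heL).exists_seq_tendsto_ae
  refine ⟨fun k => h (ns k), fun k => hhc _, fun k => hhp _, fun k => hhi _, hae, ?_⟩
  refine Tendsto.comp (g := fun k => ∫ t, h k t) ?_ hns.tendsto_atTop
  refine tendsto_iff_norm_sub_tendsto_zero.2
    (squeeze_zero (fun _ => norm_nonneg _) (fun k => ?_) hL1)
  rw [← integral_sub (hhi k) hf]
  exact norm_integral_le_integral_norm _

lemma lintegral_exp_neg_pi_mul_sum_sq (n : ℕ) :
    ∫⁻ w : Fin n → ℝ, ENNReal.ofReal (Real.exp (-Real.pi * (w ⬝ᵥ w))) = 1 := by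
  have h : (fun w : Fin n → ℝ => Real.exp (-Real.pi * (w ⬝ᵥ w))) =
      fun w => ∏ i, Real.exp (-Real.pi * (w i) ^ 2) := by
    funext w
    rw [← Real.exp_sum, dotProduct, Finset.mul_sum]
    simp only [sq]
  have hi : Integrable (fun w : Fin n → ℝ => Real.exp (-Real.pi * (w ⬝ᵥ w))) := by
    rw [h]
    exact Integrable.fintype_prod (f := fun (_ : Fin n) (t : ℝ) => Real.exp (-Real.pi * t ^ 2))
      fun _ => integrable_exp_neg_mul_sq Real.pi_pos
  rw [← ofReal_integral_eq_lintegral_ofReal hi (ae_of_all _ fun _ => (Real.exp_pos _).le), h,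
    integral_fintype_prod_volume_eq_prod
      (f := fun (_ : Fin n) (t : ℝ) => Real.exp (-Real.pi * t ^ 2))]
  simp only [integral_gaussian, div_self Real.pi_ne_zero, Real.sqrt_one, Finset.prod_const_one,
    ENNReal.ofReal_one]

section FrameOperator

variable {ι κ : Type*} [Fintype ι] [Fintype κ]

lemma sum_smul_vecMulVec_mulVec (d : ι → ℝ) (u : ι → κ → ℝ) (x : κ → ℝ) :
    (∑ j, d j • Matrix.vecMulVec (u j) (u j)) *ᵥ x = ∑ j, (d j * (x ⬝ᵥ u j)) • u j := by
  rw [Matrix.sum_mulVec]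
  refine Finset.sum_congr rfl fun j _ => ?_
  rw [Matrix.smul_mulVec, Matrix.vecMulVec_mulVec, dotProduct_comm]
  simp [smul_smul]

lemma sum_smul_dotProduct (d : ι → ℝ) (u : ι → κ → ℝ) (x : κ → ℝ) :
    (∑ j, d j • u j) ⬝ᵥ x = ∑ j, d j * (x ⬝ᵥ u j) := by
  rw [sum_dotProduct]
  refine Finset.sum_congr rfl fun j _ => ?_
  rw [smul_dotProduct, dotProduct_comm, smul_eq_mul]

lemma posSemidef_sum_smul_vecMulVec {d : ι → ℝ} (hd : ∀ j, 0 ≤ d j) (u : ι → κ → ℝ) :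
    (∑ j, d j • Matrix.vecMulVec (u j) (u j)).PosSemidef :=
  Matrix.posSemidef_sum _ fun j _ => Matrix.PosSemidef.smul
    (by simpa using Matrix.posSemidef_vecMulVec_self_star (u j)) (hd j)

lemma dotProduct_mulVec_le [DecidableEq κ] {d : ι → ℝ} (hd : ∀ j, 0 ≤ d j) {u : ι → κ → ℝ}
    {B : Matrix κ κ ℝ} (hB : B.det ≠ 0)
    (hA : ∑ j, d j • Matrix.vecMulVec (u j) (u j) = Bᵀ * B) (s : ι → ℝ) :
    ((Bᵀ)⁻¹ *ᵥ ∑ j, (d j * s j) • u j) ⬝ᵥ ((Bᵀ)⁻¹ *ᵥ ∑ j, (d j * s j) • u j) ≤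
      ∑ j, d j * s j ^ 2 := by
  have hU : IsUnit B.det := hB.isUnit
  have hUt : IsUnit (Bᵀ).det := by rwa [Matrix.det_transpose]
  set x := ∑ j, (d j * s j) • u j with hx
  set w := (Bᵀ)⁻¹ *ᵥ x with hw
  set z := B⁻¹ *ᵥ w with hz
  have hBz : B *ᵥ z = w := by rw [hz, Matrix.mulVec_mulVec, Matrix.mul_nonsing_inv _ hU]; simp
  have hBw : Bᵀ *ᵥ w = x := by rw [hw, Matrix.mulVec_mulVec, Matrix.mul_nonsing_inv _ hUt]; simp
  have h1 : w ⬝ᵥ w = ∑ j, d j * s j * (z ⬝ᵥ u j) := by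
    rw [← sum_smul_dotProduct, ← hx, ← hBw]
    conv_lhs => rw [← hBz]
    rw [hBz, Matrix.mulVec_transpose, ← Matrix.dotProduct_mulVec, hBz]
  have h2 : w ⬝ᵥ w = ∑ j, d j * (z ⬝ᵥ u j) * (z ⬝ᵥ u j) := by
    rw [← sum_smul_dotProduct, ← sum_smul_vecMulVec_mulVec, hA, ← Matrix.mulVec_mulVec, hBz,
      Matrix.mulVec_transpose, ← Matrix.dotProduct_mulVec, hBz]
  have h3 : 0 ≤ ∑ j, d j * (s j - z ⬝ᵥ u j) ^ 2 :=
    Finset.sum_nonneg fun j _ => mul_nonneg (hd j) (sq_nonneg _)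
  have h4 : ∑ j, d j * (s j - z ⬝ᵥ u j) ^ 2 = (∑ j, d j * s j ^ 2)
      - 2 * (∑ j, d j * s j * (z ⬝ᵥ u j)) + ∑ j, d j * (z ⬝ᵥ u j) * (z ⬝ᵥ u j) := by
    rw [Finset.mul_sum, ← Finset.sum_sub_distrib, ← Finset.sum_add_distrib]
    exact Finset.sum_congr rfl fun j _ => by ring
  linarith

lemma injective_sum_smul [DecidableEq κ] {d : ι → ℝ} (hd : ∀ j, 0 < d j) {u : ι → κ → ℝ}
    (hdet : (∑ j, d j • Matrix.vecMulVec (u j) (u j)).det ≠ 0) {T : ι → ℝ → ℝ}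
    (hT : ∀ j, StrictMono (T j)) :
    Function.Injective fun y : κ → ℝ => ∑ j, (d j * T j (y ⬝ᵥ u j)) • u j := by
  intro x y hxy
  have h0 : ∀ j ∈ Finset.univ,
      0 ≤ d j * (T j (x ⬝ᵥ u j) - T j (y ⬝ᵥ u j)) * ((x - y) ⬝ᵥ u j) := by
    intro j _
    rw [mul_assoc, sub_dotProduct]
    refine mul_nonneg (hd j).le ?_
    rcases le_total (x ⬝ᵥ u j) (y ⬝ᵥ u j) with h | h
    · exact mul_nonneg_of_nonpos_of_nonpos (sub_nonpos.2 ((hT j).monotone h)) (sub_nonpos.2 h)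
    · exact mul_nonneg (sub_nonneg.2 ((hT j).monotone h)) (sub_nonneg.2 h)
  have hs : ∑ j, d j * (T j (x ⬝ᵥ u j) - T j (y ⬝ᵥ u j)) * ((x - y) ⬝ᵥ u j) = 0 := by
    rw [← sum_smul_dotProduct]
    simp only [mul_sub, sub_smul, Finset.sum_sub_distrib]
    simp only at hxy
    rw [hxy, sub_self, zero_dotProduct]
  have hz : ∀ j, (x - y) ⬝ᵥ u j = 0 := by
    intro j
    rcases mul_eq_zero.1 ((Finset.sum_eq_zero_iff_of_nonneg h0).1 hs j
      (Finset.mem_univ j)) with h | h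
    · have h' := sub_eq_zero.1 ((mul_eq_zero.1 h).resolve_left (hd j).ne')
      rw [sub_dotProduct, (hT j).injective h', sub_self]
    · exact h
  have hA : (∑ j, d j • Matrix.vecMulVec (u j) (u j)) *ᵥ (x - y) = 0 := by
    rw [sum_smul_vecMulVec_mulVec]
    simp [hz]
  exact sub_eq_zero.1 (Matrix.eq_zero_of_mulVec_eq_zero hdet hA)

lemma hasFDerivAt_sum_smul [DecidableEq κ] (d : ι → ℝ) (u : ι → κ → ℝ) {T : ι → ℝ → ℝ}
    {D : ι → ℝ} {y : κ → ℝ} (hT : ∀ j, HasDerivAt (T j) (D j) (y ⬝ᵥ u j)) :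
    HasFDerivAt (fun y : κ → ℝ => ∑ j, (d j * T j (y ⬝ᵥ u j)) • u j)
      (Matrix.toLin' (∑ j, (d j * D j) • Matrix.vecMulVec (u j) (u j))).toContinuousLinearMap
      y := by
  let L : ι → (κ → ℝ) →L[ℝ] ℝ := fun j =>
    LinearMap.toContinuousLinearMap
      ((dotProductBilin ℝ ℝ : (κ → ℝ) →ₗ[ℝ] (κ → ℝ) →ₗ[ℝ] ℝ).flip (u j))
  have hL : ∀ j x, L j x = x ⬝ᵥ u j := fun j x => rfl
  have h : HasFDerivAt (fun y : κ → ℝ => ∑ j, (d j * T j (y ⬝ᵥ u j)) • u j)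
      (∑ j, (d j • D j • L j).smulRight (u j)) y :=
    HasFDerivAt.fun_sum fun j _ => HasFDerivAt.smul_const
      ((HasDerivAt.comp_hasFDerivAt (f := L j) y (hT j) (L j).hasFDerivAt).const_mul (d j)) (u j)
  convert h using 1
  ext1 x
  rw [LinearMap.coe_toContinuousLinearMap', Matrix.toLin'_apply, sum_smul_vecMulVec_mulVec]
  simp [hL, mul_assoc]

end FrameOperator

lemma integral_pos_of_forall_pos {p : ℝ → ℝ} (hpos : ∀ t, 0 < p t) (hpi : Integrable p) :
    0 < ∫ t, p t := by
  refine (integral_pos_iff_support_of_nonneg (fun t => (hpos t).le) hpi).2 ?_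
  have : Function.support p = Set.univ := Set.eq_univ_of_forall fun t => (hpos t).ne'
  simp [this]

lemma lintegral_prod_rpow_le {ι : Type*} [Fintype ι] {n : ℕ} {u : ι → Fin n → ℝ} {c : ι → ℝ}
    (hc : ∀ j, 0 < c j) {F : ℝ} (hF : 0 < F)
    (hdet : ∀ lam : ι → ℝ, (∀ j, 0 < lam j) → F * ∏ j, lam j ^ c j ≤
      (∑ j, (c j * lam j) • Matrix.vecMulVec (u j) (u j)).det)
    {f : ι → ℝ → ℝ} (hfc : ∀ j, Continuous (f j)) (hfpos : ∀ j t, 0 < f j t)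
    (hfint : ∀ j, Integrable (f j)) {a : ι → ℝ} (ha : ∀ j, 0 < a j) :
    ∫⁻ x : Fin n → ℝ, ENNReal.ofReal (∏ j, f j (x ⬝ᵥ u j) ^ c j) ≤
      ENNReal.ofReal (√(∑ j, (c j * a j ^ 2) • Matrix.vecMulVec (u j) (u j)).det /
        (F * ∏ j, a j ^ c j) * ∏ j, (∫ t, f j t) ^ c j) := by
  set I : ι → ℝ := fun j => ∫ t, f j t with hI
  have hIpos : ∀ j, 0 < I j := fun j => integral_pos_of_forall_pos (hfpos j) (hfint j)
  have hdpos : ∀ lam : ι → ℝ, (∀ j, 0 < lam j) →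
      0 < (∑ j, (c j * lam j) • Matrix.vecMulVec (u j) (u j)).det := fun lam hlam =>
    (mul_pos hF (Finset.prod_pos fun j _ => Real.rpow_pos_of_pos (hlam j) _)).trans_le
      (hdet lam hlam)
  have hq : ∀ j, ∫ t : ℝ, f j t = ∫ t : ℝ, I j * Real.exp (-Real.pi * t ^ 2) := fun j => by
    rw [integral_const_mul, integral_gaussian, div_self Real.pi_ne_zero, Real.sqrt_one, mul_one]
  choose T hTm hTd using fun j => exists_transport (hfc j) (hfpos j) (hfint j)
    (q := fun t => I j * Real.exp (-Real.pi * t ^ 2)) (by fun_prop)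
    (fun t => mul_pos (hIpos j) (Real.exp_pos _))
    ((integrable_exp_neg_mul_sq Real.pi_pos).const_mul _) (hq j)
  set D : ι → ℝ → ℝ := fun j t => f j t / (I j * Real.exp (-Real.pi * T j t ^ 2)) with hD
  have hDpos : ∀ j t, 0 < D j t := fun j t =>
    div_pos (hfpos j t) (mul_pos (hIpos j) (Real.exp_pos _))
  have hfD : ∀ j t, f j t ^ c j =
      I j ^ c j * (D j t ^ c j * Real.exp (-Real.pi * (c j * T j t ^ 2))) := fun j t => by
    have h1 : f j t = I j * (D j t * Real.exp (-Real.pi * T j t ^ 2)) := by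
      have := (hIpos j).ne'
      have := (Real.exp_pos (-Real.pi * T j t ^ 2)).ne'
      simp only [hD]
      field_simp
    rw [h1, Real.mul_rpow (hIpos j).le (mul_pos (hDpos j t) (Real.exp_pos _)).le,
      Real.mul_rpow (hDpos j t).le (Real.exp_pos _).le, ← Real.exp_mul]
    ring_nf
  set A := ∑ j, (c j * a j ^ 2) • Matrix.vecMulVec (u j) (u j) with hA
  have hAdet : 0 < A.det := hdpos _ fun j => pow_pos (ha j) 2
  obtain ⟨B, hAB⟩ : ∃ B : Matrix (Fin n) (Fin n) ℝ, A = Bᵀ * B := by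
    open scoped MatrixOrder Matrix.Norms.L2Operator in
    exact CStarAlgebra.nonneg_iff_eq_star_mul_self.1
      (posSemidef_sum_smul_vecMulVec (fun j => (mul_pos (hc j) (pow_pos (ha j) 2)).le) u).nonneg
  have hABdet : A.det = B.det ^ 2 := by rw [hAB, Matrix.det_mul, Matrix.det_transpose, sq]
  have hB : B.det ≠ 0 := fun h => by simp [hABdet, h] at hAdet
  have hsqrt : √A.det = |B.det| := by rw [hABdet, Real.sqrt_sq_eq_abs]
  set C := (Bᵀ)⁻¹ with hC
  have hCdet : |C.det| = (√A.det)⁻¹ := by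
    rw [hC, Matrix.det_nonsing_inv, Matrix.det_transpose, Ring.inverse_eq_inv', abs_inv, hsqrt]
  have hC0 : C.det ≠ 0 := by
    rw [← abs_pos, hCdet, inv_pos]
    exact Real.sqrt_pos.2 hAdet
  let Ψ : (Fin n → ℝ) → Fin n → ℝ := fun y =>
    C *ᵥ ∑ j, (c j * a j * T j (y ⬝ᵥ u j)) • u j
  let M : (Fin n → ℝ) → Matrix (Fin n) (Fin n) ℝ := fun y =>
    ∑ j, (c j * a j * D j (y ⬝ᵥ u j)) • Matrix.vecMulVec (u j) (u j)
  have hΨd : ∀ y, HasFDerivAt Ψ (Matrix.toLin' (C * M y)).toContinuousLinearMap y := fun y => by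
    have h := ((Matrix.toLin' C).toContinuousLinearMap.hasFDerivAt).comp y
      (hasFDerivAt_sum_smul (fun j => c j * a j) u (y := y) fun j => hTd j (y ⬝ᵥ u j))
    rw [Matrix.toLin'_mul]
    exact h
  have hΨi : Function.Injective Ψ := (Matrix.mulVec_injective_of_isUnit
    ((Matrix.isUnit_iff_isUnit_det _).2 hC0.isUnit)).comp
    (injective_sum_smul (fun j => mul_pos (hc j) (ha j)) (hdpos a ha).ne' hTm)
  have hcov := lintegral_image_eq_lintegral_abs_det_fderiv_mul volume MeasurableSet.univ
    (fun y _ => (hΨd y).hasFDerivWithinAt) hΨi.injOn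
    (fun w => ENNReal.ofReal (Real.exp (-Real.pi * (w ⬝ᵥ w))))
  have hle := (setLIntegral_le_lintegral (μ := volume) (Ψ '' Set.univ)
    (fun w => ENNReal.ofReal (Real.exp (-Real.pi * (w ⬝ᵥ w))))).trans_eq
    (lintegral_exp_neg_pi_mul_sum_sq n)
  rw [hcov, Measure.restrict_univ] at hle
  have hap : 0 < ∏ j, a j ^ c j := Finset.prod_pos fun j _ => Real.rpow_pos_of_pos (ha j) _
  have hIp : 0 < ∏ j, I j ^ c j := Finset.prod_pos fun j _ => Real.rpow_pos_of_pos (hIpos j) _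
  set K := √A.det / (F * ∏ j, a j ^ c j) * ∏ j, I j ^ c j with hK
  have hKpos : 0 < K := mul_pos (div_pos (Real.sqrt_pos.2 hAdet) (mul_pos hF hap)) hIp
  have hpt : ∀ y : Fin n → ℝ, ∏ j, f j (y ⬝ᵥ u j) ^ c j ≤
      K * (|(C * M y).det| * Real.exp (-Real.pi * (Ψ y ⬝ᵥ Ψ y))) := fun y => by
    have h1 : F * ∏ j, (a j * D j (y ⬝ᵥ u j)) ^ c j ≤ (M y).det := by
      refine (hdet (fun j => a j * D j (y ⬝ᵥ u j)) fun j => mul_pos (ha j) (hDpos j _)).trans_eq ?_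
      simp only [M, mul_assoc]
    have h2 : Ψ y ⬝ᵥ Ψ y ≤ ∑ j, c j * T j (y ⬝ᵥ u j) ^ 2 := by
      have := dotProduct_mulVec_le (fun j => (mul_pos (hc j) (pow_pos (ha j) 2)).le) hB
        (hA.symm.trans hAB) fun j => T j (y ⬝ᵥ u j) / a j
      have e1 : ∀ j, c j * a j ^ 2 * (T j (y ⬝ᵥ u j) / a j) = c j * a j * T j (y ⬝ᵥ u j) :=
        fun j => by have := (ha j).ne'; field_simp
      have e2 : ∀ j, c j * a j ^ 2 * (T j (y ⬝ᵥ u j) / a j) ^ 2 = c j * T j (y ⬝ᵥ u j) ^ 2 :=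
        fun j => by have := (ha j).ne'; field_simp
      simpa only [e1, e2] using this
    have h3 : Real.exp (-Real.pi * ∑ j, c j * T j (y ⬝ᵥ u j) ^ 2) ≤
        Real.exp (-Real.pi * (Ψ y ⬝ᵥ Ψ y)) :=
      Real.exp_le_exp.2 (mul_le_mul_of_nonpos_left h2 (by linarith [Real.pi_pos]))
    have hDp : 0 < ∏ j, D j (y ⬝ᵥ u j) ^ c j :=
      Finset.prod_pos fun j _ => Real.rpow_pos_of_pos (hDpos j _) _
    have h4 : ∏ j, (a j * D j (y ⬝ᵥ u j)) ^ c j =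
        (∏ j, a j ^ c j) * ∏ j, D j (y ⬝ᵥ u j) ^ c j := by
      rw [← Finset.prod_mul_distrib]
      exact Finset.prod_congr rfl fun j _ => Real.mul_rpow (ha j).le (hDpos j _).le
    rw [h4] at h1
    calc ∏ j, f j (y ⬝ᵥ u j) ^ c j
        = (∏ j, I j ^ c j) * ((∏ j, D j (y ⬝ᵥ u j) ^ c j) *
            Real.exp (-Real.pi * ∑ j, c j * T j (y ⬝ᵥ u j) ^ 2)) := by
          rw [Finset.mul_sum, Real.exp_sum, ← Finset.prod_mul_distrib, ← Finset.prod_mul_distrib]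
          exact Finset.prod_congr rfl fun j _ => hfD j _
      _ = K * ((√A.det)⁻¹ * (F * ((∏ j, a j ^ c j) * ∏ j, D j (y ⬝ᵥ u j) ^ c j)) *
            Real.exp (-Real.pi * ∑ j, c j * T j (y ⬝ᵥ u j) ^ 2)) := by
          have := (Real.sqrt_pos.2 hAdet).ne'
          have := hap.ne'
          have := hF.ne'
          rw [hK]
          field_simp
      _ ≤ _ := by
          rw [Matrix.det_mul, abs_mul, hCdet]
          have := h1.trans (le_abs_self _)
          gcongr
  calc ∫⁻ y : Fin n → ℝ, ENNReal.ofReal (∏ j, f j (y ⬝ᵥ u j) ^ c j)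
      ≤ ∫⁻ y : Fin n → ℝ, ENNReal.ofReal K * (ENNReal.ofReal |(C * M y).det| *
          ENNReal.ofReal (Real.exp (-Real.pi * (Ψ y ⬝ᵥ Ψ y)))) := by
        refine lintegral_mono fun y => ?_
        rw [← ENNReal.ofReal_mul (abs_nonneg _), ← ENNReal.ofReal_mul hKpos.le]
        exact ENNReal.ofReal_le_ofReal (hpt y)
    _ = ENNReal.ofReal K * ∫⁻ y : Fin n → ℝ, ENNReal.ofReal |(C * M y).det| *
          ENNReal.ofReal (Real.exp (-Real.pi * (Ψ y ⬝ᵥ Ψ y))) :=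
        lintegral_const_mul' _ _ ENNReal.ofReal_ne_top
    _ ≤ ENNReal.ofReal K * 1 := by
        gcongr
        simpa only [ContinuousLinearMap.det, LinearMap.coe_toContinuousLinearMap,
          LinearMap.det_toLin'] using hle
    _ = ENNReal.ofReal K := mul_one _

lemma ae_comp_dotProduct {n : ℕ} {v : Fin n → ℝ} (hv : v ≠ 0) {p : ℝ → Prop}
    (hp : ∀ᵐ t, p t) : ∀ᵐ x : Fin n → ℝ, p (x ⬝ᵥ v) := by
  let L : (Fin n → ℝ) →ₗ[ℝ] ℝ :=
    (dotProductBilin ℝ ℝ : (Fin n → ℝ) →ₗ[ℝ] (Fin n → ℝ) →ₗ[ℝ] ℝ).flip v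
  have hL : ∀ x, L x = x ⬝ᵥ v := fun x => rfl
  have hs : Function.Surjective L := LinearMap.surjective fun h => hv <|
    dotProduct_self_eq_zero.1 (by rw [← hL, h, LinearMap.zero_apply])
  obtain ⟨k, -, hk⟩ := L.exists_map_addHaar_eq_smul_addHaar volume volume hs
  have hmap : ∀ᵐ t ∂(Measure.map L volume), p t := by
    rw [hk]
    exact Measure.ae_smul_measure hp k
  simpa only [hL] using
    ae_of_ae_map (LinearMap.continuous_of_finiteDimensional L).aemeasurable hmap

lemma ne_zero_of_forall_mul_prod_rpow_le {ι κ : Type*} [Fintype ι] [Fintype κ] [DecidableEq κ]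
    {u : ι → κ → ℝ} {c : ι → ℝ} (hc : ∀ j, 0 < c j) {F : ℝ} (hF : 0 < F)
    (hdet : ∀ lam : ι → ℝ, (∀ j, 0 < lam j) → F * ∏ j, lam j ^ c j ≤
      (∑ j, (c j * lam j) • Matrix.vecMulVec (u j) (u j)).det) (i : ι) : u i ≠ 0 := by
  classical
  intro hi
  set d := (∑ j, (c j * 1) • Matrix.vecMulVec (u j) (u j)).det with hd
  have hd0 : 0 < d := lt_of_lt_of_le (by simpa using hF) (hdet (fun _ => 1) fun _ => one_pos)
  have hs : 0 < (d + 1) / F := by positivity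
  set lam : ι → ℝ := Function.update 1 i (((d + 1) / F) ^ (c i)⁻¹) with hlam
  have hlpos : ∀ j, 0 < lam j := fun j => by
    rcases eq_or_ne j i with rfl | h
    · simpa [hlam] using Real.rpow_pos_of_pos hs _
    · simp [hlam, h]
  have h1 := hdet lam hlpos
  have h2 : ∑ j, (c j * lam j) • Matrix.vecMulVec (u j) (u j) =
      ∑ j, (c j * 1) • Matrix.vecMulVec (u j) (u j) := by
    refine Finset.sum_congr rfl fun j _ => ?_
    rcases eq_or_ne j i with rfl | h
    · simp [hi]
    · simp [hlam, h]
  have h3 : ∏ j, lam j ^ c j = (d + 1) / F := by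
    rw [Finset.prod_eq_single i (fun j _ h => by simp [hlam, h]) (by simp)]
    simp only [hlam, Function.update_self]
    exact Real.rpow_inv_rpow hs.le (hc i).ne'
  rw [h2, h3, mul_div_cancel₀ _ hF.ne'] at h1
  linarith

open Filter Topology in
/-- Brascamp–Lieb: let `m ≥ n`, `uⱼ ∈ ℝⁿ`, `cⱼ > 0` with `Σ cⱼ = n`, and let
`F = inf { det(Σ cⱼ λⱼ uⱼ ⊗ uⱼ) / Π λⱼ^{cⱼ} : λⱼ > 0 }`. Then for all nonnegative
integrable `fⱼ : ℝ → ℝ` one has `√F · ∫_{ℝⁿ} Π fⱼ(⟨x,uⱼ⟩)^{cⱼ} dx ≤ Π (∫ fⱼ)^{cⱼ}`. -/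
theorem brascamp_lieb (n m : ℕ) (hmn : n ≤ m)
    (u : Fin m → Fin n → ℝ)
    (c : Fin m → ℝ) (hc : ∀ j, 0 < c j) (hsum : ∑ j, c j = n)
    (F : ℝ)
    (hF : F = sInf {r : ℝ | ∃ lam : Fin m → ℝ, (∀ j, 0 < lam j) ∧
        r = (∑ j, (c j * lam j) • Matrix.vecMulVec (u j) (u j)).det / ∏ j, lam j ^ c j})
    (f : Fin m → ℝ → ℝ) (hf0 : ∀ j t, 0 ≤ f j t) (hf : ∀ j, Integrable (f j)) :
    Real.sqrt F * ∫ x : Fin n → ℝ, ∏ j, f j (x ⬝ᵥ u j) ^ c j ≤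
      ∏ j, (∫ t : ℝ, f j t) ^ c j := by
  have hR : 0 ≤ ∏ j, (∫ t : ℝ, f j t) ^ c j :=
    Finset.prod_nonneg fun j _ => Real.rpow_nonneg (integral_nonneg (hf0 j)) _
  rcases le_or_gt F 0 with hF0 | hF0
  · rwa [Real.sqrt_eq_zero_of_nonpos hF0, zero_mul]
  have hprod : ∀ lam : Fin m → ℝ, (∀ j, 0 < lam j) → 0 < ∏ j, lam j ^ c j := fun lam hlam =>
    Finset.prod_pos fun j _ => Real.rpow_pos_of_pos (hlam j) _
  have hdet : ∀ lam : Fin m → ℝ, (∀ j, 0 < lam j) → F * ∏ j, lam j ^ c j ≤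
      (∑ j, (c j * lam j) • Matrix.vecMulVec (u j) (u j)).det := fun lam hlam => by
    rw [← le_div_iff₀ (hprod lam hlam), hF]
    refine csInf_le ⟨0, ?_⟩ ⟨lam, hlam, rfl⟩
    rintro _ ⟨l, hl, rfl⟩
    exact div_nonneg
      (posSemidef_sum_smul_vecMulVec (fun j => (mul_pos (hc j) (hl j)).le) u).det_nonneg
      (hprod l hl).le
  have hu : ∀ j, u j ≠ 0 := ne_zero_of_forall_mul_prod_rpow_le hc hF0 hdet
  have key : ∀ g : Fin m → ℝ → ℝ, (∀ j, Continuous (g j)) → (∀ j t, 0 < g j t) →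
      (∀ j, Integrable (g j)) →
      ∫⁻ x : Fin n → ℝ, ENNReal.ofReal (∏ j, g j (x ⬝ᵥ u j) ^ c j) ≤
        ENNReal.ofReal ((∏ j, (∫ t, g j t) ^ c j) / √F) := by
    intro g hgc hgp hgi
    set P := ∏ j, (∫ t, g j t) ^ c j with hP
    have hP0 : 0 ≤ P :=
      Finset.prod_nonneg fun j _ => Real.rpow_nonneg (integral_nonneg fun t => (hgp j t).le) _
    have hbound := fun a : Fin m → ℝ => lintegral_prod_rpow_le (a := a) hc hF0 hdet hgc hgp hgi
    rw [← hP] at hbound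
    set J := ∫⁻ x : Fin n → ℝ, ENNReal.ofReal (∏ j, g j (x ⬝ᵥ u j) ^ c j) with hJ
    have hJtop : J ≠ ⊤ := ne_top_of_le_ne_top ENNReal.ofReal_ne_top
      (hbound (fun _ => 1) fun _ => one_pos)
    rw [← ENNReal.ofReal_toReal hJtop]
    refine ENNReal.ofReal_le_ofReal ?_
    have hsq : ∀ lam : Fin m → ℝ, (∀ j, 0 < lam j) → F * J.toReal ≤
        √((∑ j, (c j * lam j) • Matrix.vecMulVec (u j) (u j)).det / ∏ j, lam j ^ c j) * P := by
      intro lam hlam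
      have h1 := ENNReal.toReal_le_of_le_ofReal (by positivity)
        (hbound (fun j => √(lam j)) fun j => Real.sqrt_pos.2 (hlam j))
      simp only [Real.sq_sqrt (hlam _).le] at h1
      have h2 : ∏ j, √(lam j) ^ c j = √(∏ j, lam j ^ c j) := by
        rw [Real.sqrt_eq_rpow,
          ← Real.finsetProd_rpow _ _ fun j _ => (Real.rpow_pos_of_pos (hlam j) _).le]
        refine Finset.prod_congr rfl fun j _ => ?_
        rw [Real.sqrt_eq_rpow, ← Real.rpow_mul (hlam j).le, ← Real.rpow_mul (hlam j).le, mul_comm]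
      rw [h2] at h1
      have h3 := Real.sqrt_pos.2 (hprod lam hlam)
      calc F * J.toReal ≤ F * _ := mul_le_mul_of_nonneg_left h1 hF0.le
        _ = _ := by
          rw [Real.sqrt_div' _ (hprod lam hlam).le]
          field_simp
    have hPpos : 0 < P := Finset.prod_pos fun j _ => Real.rpow_pos_of_pos
      (integral_pos_of_forall_pos (hgp j) (hgi j)) _
    have h4 : (F * J.toReal / P) ^ 2 ≤ F := by
      conv_rhs => rw [hF]
      refine le_csInf ⟨_, fun _ => 1, fun _ => one_pos, rfl⟩ ?_
      rintro _ ⟨lam, hlam, rfl⟩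
      refine (Real.le_sqrt (by positivity) ?_).1 ((div_le_iff₀ hPpos).2 (hsq lam hlam))
      exact hF0.le.trans ((le_div_iff₀ (hprod lam hlam)).2 (hdet lam hlam))
    have h5 : F * J.toReal / P ≤ √F := Real.le_sqrt_of_sq_le h4
    rw [div_le_iff₀ hPpos] at h5
    have h6 := Real.sqrt_pos.2 hF0
    rw [le_div_iff₀' h6]
    refine le_of_mul_le_mul_left ?_ h6
    rwa [← mul_assoc, Real.mul_self_sqrt hF0.le]
  choose g hgc hgp hgi hga hgl using fun j => exists_seq_continuous_pos (hf0 j) (hf j)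
  have hlim : Tendsto (fun k => ENNReal.ofReal ((∏ j, (∫ t, g j k t) ^ c j) / √F)) atTop
      (𝓝 (ENNReal.ofReal ((∏ j, (∫ t, f j t) ^ c j) / √F))) :=
    ENNReal.tendsto_ofReal <| Tendsto.div_const
      (tendsto_finsetProd _ fun j _ => (hgl j).rpow_const (Or.inr (hc j).le)) _
  have hae : ∀ᵐ x : Fin n → ℝ, ENNReal.ofReal (∏ j, f j (x ⬝ᵥ u j) ^ c j) ≤
      liminf (fun k => ENNReal.ofReal (∏ j, g j k (x ⬝ᵥ u j) ^ c j)) atTop := by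
    filter_upwards [ae_all_iff.2 fun j => ae_comp_dotProduct (hu j) (hga j)] with x hx
    exact (ENNReal.tendsto_ofReal <| tendsto_finsetProd _ fun j _ =>
      (hx j).rpow_const (Or.inr (hc j).le)).liminf_eq.ge
  have hmeas : ∀ k, Measurable fun x : Fin n → ℝ =>
      ENNReal.ofReal (∏ j, g j k (x ⬝ᵥ u j) ^ c j) := fun k => by
    refine ENNReal.measurable_ofReal.comp (Continuous.measurable ?_)
    refine continuous_finsetProd _ fun j _ => Continuous.rpow_const ?_ fun _ => Or.inr (hc j).le
    exact (hgc j k).comp (by fun_prop)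
  have hmain : ∫⁻ x : Fin n → ℝ, ENNReal.ofReal (∏ j, f j (x ⬝ᵥ u j) ^ c j) ≤
      ENNReal.ofReal ((∏ j, (∫ t, f j t) ^ c j) / √F) :=
    calc _ ≤ _ := lintegral_mono_ae hae
      _ ≤ _ := lintegral_liminf_le hmeas
      _ ≤ _ := liminf_le_liminf (Eventually.of_forall fun k =>
        key (fun j => g j k) (fun j => hgc j k) (fun j => hgp j k) fun j => hgi j k)
      _ = _ := hlim.liminf_eq
  rw [← le_div_iff₀' (Real.sqrt_pos.2 hF0)]
  by_cases hm : AEStronglyMeasurable (fun x : Fin n → ℝ => ∏ j, f j (x ⬝ᵥ u j) ^ c j) volume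
  · rw [integral_eq_lintegral_of_nonneg_ae
      (ae_of_all _ fun x => Finset.prod_nonneg fun j _ => Real.rpow_nonneg (hf0 j _) _) hm]
    exact ENNReal.toReal_le_of_le_ofReal (by positivity) hmain
  · rw [integral_non_aestronglyMeasurable hm]
    positivity
end

section
/- Let K be a symmetric convex body in ℝⁿ in John's position. Then for every d > 1 there exist s ≤ dn and unit vectors w_1, …, w_s ∈ S^{n−1} such that K ⊆ P := ⋂_{j=1}^s {x ∈ ℝⁿ : |⟨x, w_j⟩| ≤ 1} and |P|^{1/n} ≤ 2(√d + 1)/(√d − 1). -/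
open MeasureTheory
open scoped RealInnerProductSpace

open Real Set Filter Topology in
theorem exists_gaussian_transport :
    ∃ Φ : ℝ → ℝ, ∀ t ∈ Set.Ioo (-1 : ℝ) 1,
      HasDerivAt Φ (Real.exp (Real.pi * Φ t ^ 2) / 2) t := by
  set g : ℝ → ℝ := fun s => 2 * Real.exp (-Real.pi * s ^ 2) with hg
  have hgc : Continuous g := by fun_prop
  set F : ℝ → ℝ := fun x => ∫ s in (0 : ℝ)..x, g s with hF
  have hFd : ∀ x, HasDerivAt F (g x) x := fun x =>
    intervalIntegral.integral_hasDerivAt_right (hgc.intervalIntegrable _ _)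
      hgc.stronglyMeasurable.stronglyMeasurableAtFilter hgc.continuousAt
  have hgpos : ∀ x, 0 < g x := fun x => by positivity
  have hFmono : StrictMono F := strictMono_of_deriv_pos fun x => by
    rw [(hFd x).deriv]; exact hgpos x
  have hFcont : Continuous F := continuous_iff_continuousAt.2 fun x => (hFd x).continuousAt
  have hgi : Integrable g := (integrable_exp_neg_mul_sq Real.pi_pos).const_mul 2
  have hFtop : Tendsto F atTop (𝓝 1) := by
    have h := intervalIntegral_tendsto_integral_Ioi 0 hgi.integrableOn tendsto_id
    have h1 : ∫ x in Ioi (0 : ℝ), g x = 1 := by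
      rw [hg, integral_const_mul, integral_gaussian_Ioi, div_self Real.pi_pos.ne']
      simp
    rw [h1] at h
    exact h
  have hFodd : ∀ x, F (-x) = -F x := fun x => by
    have h := intervalIntegral.integral_comp_neg (a := 0) (b := x) g
    have h2 : (fun s => g (-s)) = g := by funext s; simp [hg]
    rw [h2, neg_zero] at h
    simp only [hF]
    rw [h, intervalIntegral.integral_symm]
  have hlt : ∀ x, F x < 1 := fun x =>
    (hFmono (lt_add_one x)).trans_le (hFmono.monotone.ge_of_tendsto hFtop _)
  have hgt : ∀ x, -1 < F x := fun x => by
    have := hlt (-x); rw [hFodd] at this; linarith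
  have hsurj : ∀ t ∈ Ioo (-1 : ℝ) 1, ∃ x, F x = t := by
    intro t ht
    obtain ⟨b, hb⟩ := (hFtop.eventually (lt_mem_nhds ht.2)).exists
    obtain ⟨a, ha⟩ := (hFtop.eventually (lt_mem_nhds (show -t < 1 by linarith [ht.1]))).exists
    have ha' : F (-a) < t := by rw [hFodd]; linarith
    exact mem_range_of_exists_le_of_exists_ge hFcont ⟨_, ha'.le⟩ ⟨_, hb.le⟩
  set Φ := Function.invFun F
  have hright : ∀ t ∈ Ioo (-1 : ℝ) 1, F (Φ t) = t := fun t ht =>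
    Function.invFun_eq (hsurj t ht)
  have hleft : ∀ x, Φ (F x) = x := Function.leftInverse_invFun hFmono.injective
  have hΦmono : StrictMonoOn Φ (Ioo (-1) 1) := fun a ha b hb hab => by
    rw [← hFmono.lt_iff_lt, hright a ha, hright b hb]; exact hab
  refine ⟨Φ, fun t ht => ?_⟩
  have hnhds : Ioo (-1 : ℝ) 1 ∈ 𝓝 t := Ioo_mem_nhds ht.1 ht.2
  have hc : ContinuousAt Φ t := by
    refine hΦmono.continuousAt_of_image_mem_nhds hnhds ?_
    convert univ_mem
    exact eq_univ_of_forall fun x => ⟨F x, ⟨hgt x, hlt x⟩, hleft x⟩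
  have hd := HasDerivAt.of_local_left_inverse hc (hFd (Φ t)) (hgpos _).ne'
    (eventually_of_mem hnhds hright)
  have hinv : Real.exp (Real.pi * Φ t ^ 2) / 2 = (g (Φ t))⁻¹ := by
    simp only [hg]
    rw [neg_mul, Real.exp_neg, mul_inv, inv_inv]
    ring
  rwa [hinv]

theorem prod_rpow_le_det_of_parseval {n m : ℕ}
    (v : Fin m → EuclideanSpace ℝ (Fin n)) (hv : ∀ x, ∑ i, ⟪v i, x⟫ ^ 2 = ‖x‖ ^ 2)
    (s : Fin m → ℝ) (hs : ∀ i, 0 < s i)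
    (M : EuclideanSpace ℝ (Fin n) →ₗ[ℝ] EuclideanSpace ℝ (Fin n))
    (hM : ∀ x, M x = ∑ i, (s i * ⟪v i, x⟫) • v i) :
    ∏ i, s i ^ (‖v i‖ ^ 2) ≤ LinearMap.det M := by
  have hsym : M.IsSymmetric := fun x y => by
    simp only [hM, sum_inner, inner_sum, real_inner_smul_left, real_inner_smul_right]
    refine Finset.sum_congr rfl fun i _ => ?_
    rw [real_inner_comm x]; ring
  have hfr : Module.finrank ℝ (EuclideanSpace ℝ (Fin n)) = n := by simp
  set b := hsym.eigenvectorBasis hfr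
  have hdet := hsym.det_eq_prod_eigenvalues hfr
  have hev : ∀ k, hsym.eigenvalues hfr k = ∑ i, ⟪v i, b k⟫ ^ 2 * s i := fun k => by
    have h1 : ⟪b k, M (b k)⟫ = hsym.eigenvalues hfr k := by
      rw [hsym.apply_eigenvectorBasis hfr k]
      simp [real_inner_smul_right, b]
    rw [← h1, hM, inner_sum]
    refine Finset.sum_congr rfl fun i _ => ?_
    rw [real_inner_smul_right, real_inner_comm]; ring
  have hpars : ∀ i, ‖v i‖ ^ 2 = ∑ k, ⟪v i, b k⟫ ^ 2 := fun i => by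
    have := b.sum_sq_norm_inner_left (v i)
    simpa using this.symm
  rw [hdet]
  calc ∏ i, s i ^ (‖v i‖ ^ 2) = ∏ k, ∏ i, s i ^ (⟪v i, b k⟫ ^ 2) := by
        rw [Finset.prod_comm]
        refine Finset.prod_congr rfl fun i _ => ?_
        rw [hpars, Real.rpow_sum_of_pos (hs i)]
    _ ≤ ∏ k, hsym.eigenvalues hfr k := by
        refine Finset.prod_le_prod (fun k _ => Finset.prod_nonneg fun i _ =>
          (Real.rpow_pos_of_pos (hs i) _).le) fun k _ => ?_
        rw [hev]
        exact Real.geom_mean_le_arith_mean_weighted _ _ _ (fun i _ => sq_nonneg _)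
          (by rw [hv]; simp) (fun i _ => (hs i).le)
    _ = _ := by simp

theorem norm_sum_smul_sq_le_of_parseval {n m : ℕ}
    (v : Fin m → EuclideanSpace ℝ (Fin n)) (hv : ∀ x, ∑ i, ⟪v i, x⟫ ^ 2 = ‖x‖ ^ 2)
    (a : Fin m → ℝ) : ‖∑ i, a i • v i‖ ^ 2 ≤ ∑ i, a i ^ 2 := by
  set z := ∑ i, a i • v i
  have h1 : ‖z‖ ^ 2 = ∑ i, a i * ⟪v i, z⟫ := by
    rw [← real_inner_self_eq_norm_sq]
    conv_lhs => rw [show z = ∑ i, a i • v i from rfl, sum_inner]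
    simp [real_inner_smul_left, z]
  have h2 : 0 ≤ ∑ i, (a i - ⟪v i, z⟫) ^ 2 := Finset.sum_nonneg fun i _ => sq_nonneg _
  have h3 : ∑ i, (a i - ⟪v i, z⟫) ^ 2 =
      ∑ i, a i ^ 2 - 2 * ∑ i, a i * ⟪v i, z⟫ + ∑ i, ⟪v i, z⟫ ^ 2 := by
    rw [Finset.mul_sum, ← Finset.sum_sub_distrib, ← Finset.sum_add_distrib]
    exact Finset.sum_congr rfl fun i _ => by ring
  rw [h3, ← h1, hv] at h2
  linarith

theorem sum_norm_sq_of_parseval {n m : ℕ}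
    (v : Fin m → EuclideanSpace ℝ (Fin n)) (hv : ∀ x, ∑ i, ⟪v i, x⟫ ^ 2 = ‖x‖ ^ 2) :
    ∑ i, ‖v i‖ ^ 2 = n := by
  have b := EuclideanSpace.basisFun (Fin n) ℝ
  have hpars : ∀ i, ‖v i‖ ^ 2 = ∑ k, ⟪v i, b k⟫ ^ 2 := fun i => by
    have := b.sum_sq_norm_inner_left (v i)
    simpa using this.symm
  simp_rw [hpars]
  rw [Finset.sum_comm]
  simp [hv]

open Set in
theorem volume_open_strips_le_of_parseval {n m : ℕ}
    (v : Fin m → EuclideanSpace ℝ (Fin n)) (hv : ∀ x, ∑ i, ⟪v i, x⟫ ^ 2 = ‖x‖ ^ 2)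
    {ρ : ℝ} (hρ : 0 < ρ) (hρv : ∀ i, ρ ≤ ‖v i‖ ^ 2) :
    volume {y : EuclideanSpace ℝ (Fin n) | ∀ i, |⟪v i, y⟫| < 1} ≤
      ENNReal.ofReal ((2 / √ρ) ^ n) := by
  obtain ⟨Φ, hΦ⟩ := exists_gaussian_transport
  set S := {y : EuclideanSpace ℝ (Fin n) | ∀ i, |⟪v i, y⟫| < 1} with hS
  have hSmem : ∀ y ∈ S, ∀ i, ⟪v i, y⟫ ∈ Ioo (-1 : ℝ) 1 := fun y hy i => abs_lt.1 (hy i)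
  have hSopen : IsOpen S := by
    rw [hS, ofPred_forall]
    exact isOpen_iInter_of_finite fun i => isOpen_lt (by fun_prop) continuous_const
  have hnorm : ∀ i, √ρ ≤ ‖v i‖ := fun i => Real.sqrt_le_iff.2 ⟨norm_nonneg _, hρv i⟩
  have hsρ : 0 < √ρ := Real.sqrt_pos.2 hρ
  have hvpos : ∀ i, 0 < ‖v i‖ := fun i => hsρ.trans_le (hnorm i)
  have hΦmono : StrictMonoOn Φ (Ioo (-1) 1) := by
    refine strictMonoOn_of_deriv_pos (convex_Ioo _ _)
      (fun t ht => (hΦ t ht).continuousAt.continuousWithinAt) fun t ht => ?_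
    rw [interior_Ioo] at ht
    rw [(hΦ t ht).deriv]
    positivity
  set Θ : EuclideanSpace ℝ (Fin n) → EuclideanSpace ℝ (Fin n) :=
    fun y => ∑ i, (‖v i‖ * Φ ⟪v i, y⟫) • v i with hΘ
  set s : EuclideanSpace ℝ (Fin n) → Fin m → ℝ :=
    fun y i => ‖v i‖ * (Real.exp (Real.pi * Φ ⟪v i, y⟫ ^ 2) / 2) with hs
  have hspos : ∀ y i, 0 < s y i := fun y i => by
    have := hvpos i
    positivity
  set M : EuclideanSpace ℝ (Fin n) → EuclideanSpace ℝ (Fin n) →L[ℝ] EuclideanSpace ℝ (Fin n) :=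
    fun y => ∑ i, (s y i • innerSL ℝ (v i)).smulRight (v i) with hM
  have hderiv : ∀ y ∈ S, HasFDerivWithinAt Θ (M y) S y := fun y hy => by
    refine HasFDerivAt.hasFDerivWithinAt ?_
    refine HasFDerivAt.fun_sum fun i _ => ?_
    have h1 : HasFDerivAt (fun z => ⟪v i, z⟫) (innerSL ℝ (v i)) y :=
      (innerSL ℝ (v i)).hasFDerivAt
    have h2 := (((hΦ _ (hSmem y hy i)).comp_hasFDerivAt y h1).const_mul ‖v i‖).smul_const (v i)
    rw [smul_smul] at h2
    exact h2
  have hinj : InjOn Θ S := fun y hy z hz hyz => by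
    have h0 : ∑ i, ‖v i‖ * ((Φ ⟪v i, y⟫ - Φ ⟪v i, z⟫) * (⟪v i, y⟫ - ⟪v i, z⟫)) = 0 := by
      have h : ⟪Θ y - Θ z, y - z⟫ = 0 := by rw [hyz, sub_self, inner_zero_left]
      rw [← h]
      simp only [hΘ]
      rw [← Finset.sum_sub_distrib, sum_inner]
      refine Finset.sum_congr rfl fun i _ => ?_
      rw [← sub_smul, real_inner_smul_left, inner_sub_right]
      ring
    have hprod : ∀ i, 0 ≤ (Φ ⟪v i, y⟫ - Φ ⟪v i, z⟫) * (⟪v i, y⟫ - ⟪v i, z⟫) := fun i => by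
      rcases le_total ⟪v i, y⟫ ⟪v i, z⟫ with h | h
      · exact mul_nonneg_of_nonpos_of_nonpos
          (sub_nonpos.2 (hΦmono.monotoneOn (hSmem y hy i) (hSmem z hz i) h)) (sub_nonpos.2 h)
      · exact mul_nonneg
          (sub_nonneg.2 (hΦmono.monotoneOn (hSmem z hz i) (hSmem y hy i) h)) (sub_nonneg.2 h)
    have hz0 := (Finset.sum_eq_zero_iff_of_nonneg
      fun i _ => mul_nonneg (hvpos i).le (hprod i)).1 h0
    have heq : ∀ i, ⟪v i, y⟫ = ⟪v i, z⟫ := fun i => by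
      have h := hz0 i (Finset.mem_univ i)
      rcases mul_eq_zero.1 ((mul_eq_zero.1 h).resolve_left (hvpos i).ne') with h | h
      · exact hΦmono.injOn (hSmem y hy i) (hSmem z hz i) (sub_eq_zero.1 h)
      · exact sub_eq_zero.1 h
    have := hv (y - z)
    simp only [inner_sub_right, heq, sub_self] at this
    have h' : ‖y - z‖ = 0 := by
      rw [← sq_eq_zero_iff, ← this]; simp
    exact sub_eq_zero.1 (norm_eq_zero.1 h')
  have hdet : ∀ y, (√ρ / 2) ^ n ≤ |(M y).det| * Real.exp (-Real.pi * ‖Θ y‖ ^ 2) := fun y => by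
    have h1 : ∏ i, s y i ^ (‖v i‖ ^ 2) ≤ (M y).det := by
      refine prod_rpow_le_det_of_parseval v hv (s y) (hspos y) _ fun x => ?_
      simp [hM]
    have h2 : ‖Θ y‖ ^ 2 ≤ ∑ i, (‖v i‖ * Φ ⟪v i, y⟫) ^ 2 :=
      norm_sum_smul_sq_le_of_parseval v hv _
    have h3 : (√ρ / 2) ^ n * Real.exp (Real.pi * ∑ i, (‖v i‖ * Φ ⟪v i, y⟫) ^ 2) ≤
        ∏ i, s y i ^ (‖v i‖ ^ 2) := by
      have h4 : (√ρ / 2) ^ n = ∏ i, (√ρ / 2) ^ (‖v i‖ ^ 2) := by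
        rw [← Real.rpow_natCast, ← sum_norm_sq_of_parseval v hv,
          Real.rpow_sum_of_pos (by positivity)]
      rw [h4, Finset.mul_sum, Real.exp_sum, ← Finset.prod_mul_distrib]
      refine Finset.prod_le_prod (fun i _ => by positivity) fun i _ => ?_
      have h5 : Real.exp (Real.pi * (‖v i‖ * Φ ⟪v i, y⟫) ^ 2) =
          Real.exp (Real.pi * Φ ⟪v i, y⟫ ^ 2) ^ (‖v i‖ ^ 2) := by
        rw [← Real.exp_mul]; ring_nf
      rw [h5, ← Real.mul_rpow (by positivity) (by positivity)]
      refine Real.rpow_le_rpow (by positivity) ?_ (by positivity)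
      simp only [hs]
      have := mul_le_mul_of_nonneg_right (hnorm i)
        (Real.exp_pos (Real.pi * Φ ⟪v i, y⟫ ^ 2)).le
      linarith
    have h6 : (√ρ / 2) ^ n * Real.exp (Real.pi * ‖Θ y‖ ^ 2) ≤ |(M y).det| :=
      calc _ ≤ (√ρ / 2) ^ n * Real.exp (Real.pi * ∑ i, (‖v i‖ * Φ ⟪v i, y⟫) ^ 2) := by
            gcongr
        _ ≤ _ := h3.trans (h1.trans (le_abs_self _))
    calc (√ρ / 2) ^ n = (√ρ / 2) ^ n * Real.exp (Real.pi * ‖Θ y‖ ^ 2) *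
          Real.exp (-Real.pi * ‖Θ y‖ ^ 2) := by
          rw [mul_assoc, ← Real.exp_add]; simp
      _ ≤ _ := by gcongr
  have hgauss : ∫⁻ z : EuclideanSpace ℝ (Fin n),
      ENNReal.ofReal (Real.exp (-Real.pi * ‖z‖ ^ 2)) = 1 := by
    have h := GaussianFourier.integral_rexp_neg_mul_sq_norm (V := EuclideanSpace ℝ (Fin n))
      Real.pi_pos
    rw [div_self Real.pi_pos.ne', Real.one_rpow] at h
    rw [← ofReal_integral_eq_lintegral_ofReal _ (Filter.Eventually.of_forall fun z => by positivity),
      h, ENNReal.ofReal_one]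
    by_contra hni
    rw [integral_undef hni] at h
    exact zero_ne_one h
  have hkey : ENNReal.ofReal ((√ρ / 2) ^ n) * volume S ≤ 1 :=
    calc ENNReal.ofReal ((√ρ / 2) ^ n) * volume S
        = ∫⁻ _ in S, ENNReal.ofReal ((√ρ / 2) ^ n) := by rw [setLIntegral_const]
      _ ≤ ∫⁻ y in S, ENNReal.ofReal |(M y).det| *
            ENNReal.ofReal (Real.exp (-Real.pi * ‖Θ y‖ ^ 2)) := by
          refine lintegral_mono fun y => ?_
          rw [← ENNReal.ofReal_mul (abs_nonneg _)]
          exact ENNReal.ofReal_le_ofReal (hdet y)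
      _ = ∫⁻ z in Θ '' S, ENNReal.ofReal (Real.exp (-Real.pi * ‖z‖ ^ 2)) :=
          (lintegral_image_eq_lintegral_abs_det_fderiv_mul volume hSopen.measurableSet hderiv hinj
            fun z => ENNReal.ofReal (Real.exp (-Real.pi * ‖z‖ ^ 2))).symm
      _ ≤ 1 := hgauss ▸ setLIntegral_le_lintegral _ _
  have hinv : ENNReal.ofReal ((2 / √ρ) ^ n) * ENNReal.ofReal ((√ρ / 2) ^ n) = 1 := by
    rw [← ENNReal.ofReal_mul (by positivity), ← mul_pow,
      show 2 / √ρ * (√ρ / 2) = 1 by field_simp, one_pow, ENNReal.ofReal_one]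
  calc volume S = ENNReal.ofReal ((2 / √ρ) ^ n) * (ENNReal.ofReal ((√ρ / 2) ^ n) * volume S) := by
        rw [← mul_assoc, hinv, one_mul]
    _ ≤ ENNReal.ofReal ((2 / √ρ) ^ n) * 1 := by gcongr
    _ = _ := mul_one _

theorem volume_strips_le_of_parseval {n m : ℕ}
    (v : Fin m → EuclideanSpace ℝ (Fin n)) (hv : ∀ x, ∑ i, ⟪v i, x⟫ ^ 2 = ‖x‖ ^ 2)
    {ρ : ℝ} (hρ : 0 < ρ) (hρv : ∀ i, ρ ≤ ‖v i‖ ^ 2) :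
    volume {y : EuclideanSpace ℝ (Fin n) | ∀ i, |⟪v i, y⟫| ≤ 1} ≤
      ENNReal.ofReal ((2 / √ρ) ^ n) := by
  set P := {y : EuclideanSpace ℝ (Fin n) | ∀ i, |⟪v i, y⟫| ≤ 1}
  have hscale : ∀ r ∈ Set.Ioo (0 : ℝ) 1,
      ENNReal.ofReal (r ^ n) * volume P ≤ ENNReal.ofReal ((2 / √ρ) ^ n) := fun r hr => by
    have h := Measure.addHaar_smul (volume : Measure (EuclideanSpace ℝ (Fin n))) r P
    rw [finrank_euclideanSpace_fin, abs_of_nonneg (pow_nonneg hr.1.le n)] at h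
    rw [← h]
    refine (measure_mono ?_).trans (volume_open_strips_le_of_parseval v hv hρ hρv)
    rintro _ ⟨y, hy, rfl⟩ i
    simp only [real_inner_smul_right, abs_mul, abs_of_pos hr.1]
    calc r * |⟪v i, y⟫| ≤ r * 1 := by gcongr; exacts [hr.1.le, hy i]
      _ < 1 := by linarith [hr.2]
  have hlim : Filter.Tendsto (fun r : ℝ => ENNReal.ofReal (r ^ n) * volume P)
      (nhdsWithin 1 (Set.Iio 1)) (nhds (1 * volume P)) := by
    refine ENNReal.Tendsto.mul_const ?_ (Or.inl one_ne_zero)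
    have : Filter.Tendsto (fun r : ℝ => ENNReal.ofReal (r ^ n)) (nhds 1)
        (nhds (ENNReal.ofReal (1 ^ n))) :=
      (ENNReal.continuous_ofReal.comp (continuous_pow n)).tendsto 1
    rw [one_pow, ENNReal.ofReal_one] at this
    exact this.mono_left nhdsWithin_le_nhds
  rw [one_mul] at hlim
  exact le_of_tendsto hlim
    (Filter.eventually_of_mem (Ioo_mem_nhdsLT (zero_lt_one' ℝ)) hscale)

open scoped Matrix in
theorem Matrix.det_sub_vecMulVec_add_vecMulVec {n : ℕ} {A : Matrix (Fin n) (Fin n) ℝ}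
    (hA : A.PosDef) (u v : Fin n → ℝ) :
    (A - Matrix.vecMulVec u u + Matrix.vecMulVec v v).det =
      A.det * ((1 - u ⬝ᵥ A⁻¹ *ᵥ u) * (1 + v ⬝ᵥ A⁻¹ *ᵥ v) + (u ⬝ᵥ A⁻¹ *ᵥ v) ^ 2) := by
  set U : Matrix (Fin n) (Fin 2) ℝ := Matrix.of fun i => ![-u i, v i]
  set V : Matrix (Fin 2) (Fin n) ℝ := Matrix.of ![u, v]
  have hUV : A - Matrix.vecMulVec u u + Matrix.vecMulVec v v = A + U * V := by
    ext i j
    simp [U, V, Matrix.mul_apply, Fin.sum_univ_two, Matrix.vecMulVec_apply]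
    ring
  have hsym : v ⬝ᵥ A⁻¹ *ᵥ u = u ⬝ᵥ A⁻¹ *ᵥ v := by
    have h : A⁻¹ᵀ = A⁻¹ := by simpa using hA.inv.isHermitian.eq
    rw [Matrix.dotProduct_mulVec, ← Matrix.mulVec_transpose, h, dotProduct_comm]
  have hent : ∀ k l, (V * A⁻¹ * U) k l = V k ⬝ᵥ A⁻¹ *ᵥ (fun i => U i l) := fun k l => by
    rw [Matrix.mul_assoc]
    simp only [Matrix.mul_apply, dotProduct, Matrix.mulVec]
  have hU0 : (fun i => U i 0) = -u := by ext i; simp [U]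
  have hU1 : (fun i => U i 1) = v := by ext i; simp [U]
  have hV0 : V 0 = u := rfl
  have hV1 : V 1 = v := rfl
  rw [hUV, Matrix.det_add_mul _ _ hA.det_pos.ne'.isUnit, Matrix.det_fin_two]
  simp only [Matrix.add_apply, hent, hU0, hU1, hV0, hV1, Matrix.mulVec_neg, dotProduct_neg,
    Matrix.one_apply_eq, hsym, Matrix.one_apply_ne (zero_ne_one' (Fin 2)),
    Matrix.one_apply_ne (zero_ne_one' (Fin 2)).symm]
  ring

theorem Matrix.PosDef.det_le_trace_div_pow {n : ℕ} (hn : 1 ≤ n) {A : Matrix (Fin n) (Fin n) ℝ}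
    (hA : A.PosDef) : A.det ≤ (A.trace / n) ^ n := by
  have hn0 : (n : ℝ) ≠ 0 := by positivity
  have h := Real.geom_mean_le_arith_mean_weighted Finset.univ (fun _ : Fin n => (n : ℝ)⁻¹)
    hA.isHermitian.eigenvalues (fun _ _ => by positivity) (by simp [hn0])
    (fun i _ => (hA.eigenvalues_pos i).le)
  rw [← Finset.mul_sum] at h
  have hdet : A.det = ∏ i, hA.isHermitian.eigenvalues i := by
    simpa using hA.isHermitian.det_eq_prod_eigenvalues
  have htr : A.trace = ∑ i, hA.isHermitian.eigenvalues i := by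
    simpa using hA.isHermitian.trace_eq_sum_eigenvalues
  rw [← htr, Real.finsetProd_rpow _ _ (fun i _ => (hA.eigenvalues_pos i).le), ← hdet] at h
  have h2 := pow_le_pow_left₀ (Real.rpow_nonneg hA.det_pos.le _) h n
  rwa [Real.rpow_inv_natCast_pow hA.det_pos.le (by lia), ← div_eq_inv_mul] at h2

open scoped Matrix in
theorem exists_contact_trace_le {n : ℕ} (hn : 1 ≤ n)
    {K : Set (EuclideanSpace ℝ (Fin n))}
    (hKcompact : IsCompact K) (hKconv : Convex ℝ K)
    (hKsymm : ∀ x ∈ K, -x ∈ K)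
    (hKball : Metric.closedBall (0 : EuclideanSpace ℝ (Fin n)) 1 ⊆ K)
    (hKjohn : ∀ T : EuclideanSpace ℝ (Fin n) ≃ₗ[ℝ] EuclideanSpace ℝ (Fin n),
      T '' Metric.closedBall (0 : EuclideanSpace ℝ (Fin n)) 1 ⊆ K →
      volume (T '' Metric.closedBall (0 : EuclideanSpace ℝ (Fin n)) 1) ≤
        volume (Metric.closedBall (0 : EuclideanSpace ℝ (Fin n)) 1))
    (Q : Matrix (Fin n) (Fin n) ℝ) :
    ∃ u : EuclideanSpace ℝ (Fin n), ‖u‖ = 1 ∧ (∀ x ∈ K, |⟪x, u⟫| ≤ 1) ∧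
      Q.trace ≤ n * (u.ofLp ⬝ᵥ Q *ᵥ u.ofLp) := by
  have hn0 : (0 : ℝ) < n := by exact_mod_cast hn
  set L := Matrix.toEuclideanCLM (n := Fin n) (𝕜 := ℝ) Q with hL
  have hLq : ∀ u : EuclideanSpace ℝ (Fin n), u.ofLp ⬝ᵥ Q *ᵥ u.ofLp = ⟪u, L u⟫ := fun u => by
    rw [hL, EuclideanSpace.inner_eq_star_dotProduct, Matrix.ofLp_toEuclideanCLM, dotProduct_comm]
    simp
  set τ := Q.trace / n with hτ
  set C := {a : EuclideanSpace ℝ (Fin n) | ∀ x ∈ K, ⟪x, a⟫ ≤ 1} with hC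
  have hCball : ∀ a ∈ C, ‖a‖ ≤ 1 := fun a ha => by
    rcases eq_or_ne a 0 with rfl | h0
    · simp
    have h := ha (‖a‖⁻¹ • a) (hKball (by simp [norm_smul, h0]))
    rw [real_inner_smul_left, real_inner_self_eq_norm_sq] at h
    have : ‖a‖⁻¹ * ‖a‖ ^ 2 = ‖a‖ := by field_simp [norm_ne_zero_iff.2 h0]
    linarith
  have hCclosed : IsClosed C := by
    have : C = ⋂ x ∈ K, {a | ⟪x, a⟫ ≤ 1} := by ext; simp [hC]
    rw [this]
    exact isClosed_biInter fun x _ => isClosed_le (by fun_prop) continuous_const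
  have hCcompact : IsCompact C := by
    refine (isCompact_closedBall (0 : EuclideanSpace ℝ (Fin n)) 1).of_isClosed_subset hCclosed ?_
    intro a ha
    simpa using hCball a ha
  have happrox : ∀ η > 0, ∃ a ∈ C, 1 - ‖a‖ ^ 2 ≤ η ∧ τ * ‖a‖ ^ 2 - ⟪a, L a⟫ ≤ η := by
    intro η hη
    set H : Matrix (Fin n) (Fin n) ℝ := Q - (τ - η / 2) • 1 with hH
    have htr : 0 < H.trace := by
      have : H.trace = n * η / 2 := by
        simp only [hH, Matrix.trace_sub, Matrix.trace_smul, Matrix.trace_one, Fintype.card_fin,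
          smul_eq_mul, hτ]
        field_simp
        ring
      rw [this]
      positivity
    set N := Matrix.toEuclideanCLM (n := Fin n) (𝕜 := ℝ) H with hN
    have hNL : ∀ x, N x = L x - (τ - η / 2) • x := fun x => by
      simp [hN, hL, hH, map_sub]
    have hev1 : ∀ᶠ ε in nhdsWithin (0 : ℝ) (Set.Ioi 0), 1 < (1 + ε • H).det := by
      set p := (Matrix.det (1 + (Polynomial.X : Polynomial ℝ) •
        H.map Polynomial.C)).divX.divX
      have hcont : Continuous fun ε : ℝ => H.trace + p.eval ε * ε := by fun_prop
      have hpos : ∀ᶠ ε in nhds (0 : ℝ), 0 < H.trace + p.eval ε * ε :=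
        hcont.continuousAt.eventually (lt_mem_nhds (by simpa using htr))
      filter_upwards [hpos.filter_mono nhdsWithin_le_nhds, self_mem_nhdsWithin] with ε h1 h2
      rw [Matrix.det_one_add_smul]
      have := mul_pos h1 h2
      nlinarith
    have hev2 : ∀ᶠ ε in nhdsWithin (0 : ℝ) (Set.Ioi 0), 2 * ε * ‖N‖ + ε ^ 2 * ‖N‖ ^ 2 < η := by
      have hcont : Continuous fun ε : ℝ => 2 * ε * ‖N‖ + ε ^ 2 * ‖N‖ ^ 2 := by fun_prop
      exact (hcont.continuousAt.eventually
        (gt_mem_nhds (by simpa using hη))).filter_mono nhdsWithin_le_nhds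
    have hev3 : ∀ᶠ ε in nhdsWithin (0 : ℝ) (Set.Ioi 0), ε * ‖N‖ ^ 2 < η := by
      have hcont : Continuous fun ε : ℝ => ε * ‖N‖ ^ 2 := by fun_prop
      exact (hcont.continuousAt.eventually
        (gt_mem_nhds (by simpa using hη))).filter_mono nhdsWithin_le_nhds
    obtain ⟨ε, hdet, he2, he3, hε⟩ :=
      (hev1.and (hev2.and (hev3.and self_mem_nhdsWithin))).exists
    have hε : 0 < ε := hε
    obtain ⟨a, haC, ha⟩ : ∃ a ∈ C, 1 < ‖a + ε • N a‖ := by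
      set T := Matrix.toEuclideanCLM (n := Fin n) (𝕜 := ℝ) (star (1 + ε • H)) with hT
      have hTdet : LinearMap.det (T : EuclideanSpace ℝ (Fin n) →ₗ[ℝ] EuclideanSpace ℝ (Fin n)) =
          (1 + ε • H).det := by
        rw [hT, Matrix.coe_toEuclideanCLM_eq_toEuclideanLin,
          Matrix.toEuclideanLin_eq_toLin_orthonormal, LinearMap.det_toLin]
        rw [← Matrix.det_transpose]
        simp [Matrix.star_eq_conjTranspose]
      have hTinner : ∀ y a, ⟪T y, a⟫ = ⟪y, a + ε • N a⟫ := fun y a => by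
        rw [hT, map_star, ContinuousLinearMap.star_eq_adjoint,
          ContinuousLinearMap.adjoint_inner_left]
        simp [hN]
      have hTne : LinearMap.det (T : EuclideanSpace ℝ (Fin n) →ₗ[ℝ] EuclideanSpace ℝ (Fin n)) ≠ 0 := by
        rw [hTdet]; linarith
      have hnot : ¬ (T '' Metric.closedBall (0 : EuclideanSpace ℝ (Fin n)) 1 ⊆ K) := fun hsub => by
        have h := hKjohn (LinearMap.equivOfDetNeZero _ hTne) hsub
        have h' : ENNReal.ofReal (1 + ε • H).det *
            volume (Metric.closedBall (0 : EuclideanSpace ℝ (Fin n)) 1) ≤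
            volume (Metric.closedBall (0 : EuclideanSpace ℝ (Fin n)) 1) := by
          have h2 := Measure.addHaar_image_linearMap
            (volume : Measure (EuclideanSpace ℝ (Fin n)))
            (T : EuclideanSpace ℝ (Fin n) →ₗ[ℝ] EuclideanSpace ℝ (Fin n))
            (Metric.closedBall 0 1)
          rw [hTdet, abs_of_pos (by linarith)] at h2
          rw [← h2]
          exact h
        have hvpos : volume (Metric.closedBall (0 : EuclideanSpace ℝ (Fin n)) 1) ≠ 0 :=
          (Metric.measure_closedBall_pos _ _ one_pos).ne'
        have hvtop : volume (Metric.closedBall (0 : EuclideanSpace ℝ (Fin n)) 1) ≠ ⊤ :=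
          measure_closedBall_lt_top.ne
        nth_rewrite 2 [← one_mul (volume _)] at h'
        rw [ENNReal.mul_le_mul_iff_left hvpos hvtop, ENNReal.ofReal_le_one] at h'
        linarith
      obtain ⟨_, ⟨y, hy, rfl⟩, hyK⟩ := Set.not_subset.1 hnot
      obtain ⟨g, c, hg1, hg2⟩ := geometric_hahn_banach_closed_point hKconv hKcompact.isClosed hyK
      have hc : 0 < c := by
        have := hg1 0 (hKball (by simp))
        rwa [map_zero] at this
      set z := (InnerProductSpace.toDual ℝ (EuclideanSpace ℝ (Fin n))).symm g
      have hz : ∀ x, ⟪x, c⁻¹ • z⟫ = g x / c := fun x => by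
        rw [real_inner_smul_right, real_inner_comm, InnerProductSpace.toDual_symm_apply,
          inv_mul_eq_div]
      refine ⟨c⁻¹ • z, fun x hx => ?_, ?_⟩
      · rw [hz, div_le_one hc]
        exact (hg1 x hx).le
      · have h1 : 1 < ⟪T y, c⁻¹ • z⟫ := by rwa [hz, one_lt_div hc]
        rw [hTinner] at h1
        have h2 := real_inner_le_norm y (c⁻¹ • z + ε • N (c⁻¹ • z))
        have h3 : ‖y‖ ≤ 1 := by simpa using hy
        nlinarith [norm_nonneg (c⁻¹ • z + ε • N (c⁻¹ • z))]
    have ha1 := hCball a haC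
    have hNa : ‖N a‖ ≤ ‖N‖ := (N.le_opNorm a).trans (mul_le_of_le_one_right (norm_nonneg _) ha1)
    have hNa2 : ‖N a‖ ^ 2 ≤ ‖N‖ ^ 2 := pow_le_pow_left₀ (norm_nonneg _) hNa 2
    have hin : ⟪a, N a⟫ ≤ ‖N‖ := (real_inner_le_norm _ _).trans
      ((mul_le_of_le_one_left (norm_nonneg _) ha1).trans hNa)
    have hexp : 1 < ‖a‖ ^ 2 + 2 * ε * ⟪a, N a⟫ + ε ^ 2 * ‖N a‖ ^ 2 := by
      have h1 : 1 < ‖a + ε • N a‖ ^ 2 := one_lt_pow₀ ha two_ne_zero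
      rw [norm_add_sq_real, real_inner_smul_right, norm_smul, mul_pow, Real.norm_eq_abs,
        sq_abs] at h1
      linarith
    have hε2 : ε ^ 2 * ‖N a‖ ^ 2 ≤ ε ^ 2 * ‖N‖ ^ 2 := by gcongr
    have ha2 : ‖a‖ ^ 2 ≤ 1 := pow_le_one₀ (norm_nonneg _) ha1
    refine ⟨a, haC, ?_, ?_⟩
    · have := mul_le_mul_of_nonneg_left hin hε.le
      linarith
    · have h1 : 0 < 2 * ⟪a, N a⟫ + ε * ‖N‖ ^ 2 := by
        refine pos_of_mul_pos_right (a := ε) ?_ hε.le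
        nlinarith
      rw [hNL, inner_sub_right, real_inner_smul_right, real_inner_self_eq_norm_sq] at h1
      nlinarith
  set f : EuclideanSpace ℝ (Fin n) → ℝ :=
    fun a => max (1 - ‖a‖ ^ 2) (τ * ‖a‖ ^ 2 - ⟪a, L a⟫) with hf
  have hfc : Continuous f := by fun_prop
  obtain ⟨a, haC, hamin⟩ := hCcompact.exists_isMinOn
    (let ⟨a, ha, _⟩ := happrox 1 one_pos; ⟨a, ha⟩) hfc.continuousOn
  have hfa : f a ≤ 0 := le_of_forall_pos_le_add fun η hη => by
    obtain ⟨b, hb, h1, h2⟩ := happrox η hη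
    rw [zero_add]
    exact (hamin hb).trans (max_le h1 h2)
  obtain ⟨h1, h2⟩ := max_le_iff.1 hfa
  have hnorm : ‖a‖ = 1 := le_antisymm (hCball a haC) (by nlinarith [norm_nonneg a])
  refine ⟨a, hnorm, fun x hx => abs_le.2 ⟨?_, haC x hx⟩, ?_⟩
  · have := haC _ (hKsymm x hx)
    rw [inner_neg_left] at this
    linarith
  · rw [hLq]
    rw [hnorm, hτ] at h2
    have : Q.trace / n ≤ ⟪a, L a⟫ := by linarith
    rwa [div_le_iff₀' hn0] at this

/-- The matrix `∑ uᵢ uᵢᵀ` of the frame operator of `u`. -/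
def frameMatrix {n m : ℕ} (u : Fin m → EuclideanSpace ℝ (Fin n)) : Matrix (Fin n) (Fin n) ℝ :=
  ∑ i, Matrix.vecMulVec (u i).ofLp (u i).ofLp

open scoped Matrix in
theorem dotProduct_frameMatrix_mulVec {n m : ℕ} (u : Fin m → EuclideanSpace ℝ (Fin n))
    (x : Fin n → ℝ) : x ⬝ᵥ frameMatrix u *ᵥ x = ∑ i, ((u i).ofLp ⬝ᵥ x) ^ 2 := by
  simp only [frameMatrix, Matrix.sum_mulVec, dotProduct_sum]
  refine Finset.sum_congr rfl fun i _ => ?_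
  rw [Matrix.vecMulVec_mulVec, dotProduct_comm x]
  simp [sq, dotProduct_comm]

theorem trace_mul_frameMatrix {n m : ℕ} (u : Fin m → EuclideanSpace ℝ (Fin n))
    (B : Matrix (Fin n) (Fin n) ℝ) :
    (B * frameMatrix u).trace = ∑ i, (u i).ofLp ⬝ᵥ B.mulVec (u i).ofLp := by
  simp only [frameMatrix, Matrix.mul_sum, Matrix.trace_sum]
  refine Finset.sum_congr rfl fun i _ => ?_
  rw [Matrix.mul_vecMulVec, Matrix.trace_vecMulVec, dotProduct_comm]

theorem posSemidef_frameMatrix {n m : ℕ} (u : Fin m → EuclideanSpace ℝ (Fin n)) :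
    (frameMatrix u).PosSemidef :=
  Matrix.posSemidef_sum _ fun i _ => by
    simpa using Matrix.posSemidef_vecMulVec_self_star (u i).ofLp

theorem frameMatrix_update {n m : ℕ} (u : Fin m → EuclideanSpace ℝ (Fin n)) (i : Fin m)
    (v : EuclideanSpace ℝ (Fin n)) :
    frameMatrix (Function.update u i v) =
      frameMatrix u - Matrix.vecMulVec (u i).ofLp (u i).ofLp + Matrix.vecMulVec v.ofLp v.ofLp := by
  have h : ∑ j ∈ {i}ᶜ, Matrix.vecMulVec (Function.update u i v j).ofLp
      (Function.update u i v j).ofLp = ∑ j ∈ {i}ᶜ, Matrix.vecMulVec (u j).ofLp (u j).ofLp :=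
    Finset.sum_congr rfl fun j hj => by
      rw [Function.update_of_ne (by simpa using hj)]
  simp only [frameMatrix]
  rw [Fintype.sum_eq_add_sum_compl i, Fintype.sum_eq_add_sum_compl i, h, Function.update_self]
  abel

open scoped Matrix in
theorem exists_frame_maximizing_det {n m : ℕ} (hn : 1 ≤ n) (hnm : n ≤ m)
    {U : Set (EuclideanSpace ℝ (Fin n))} (hU : IsCompact U)
    (hspan : Submodule.span ℝ U = ⊤) :
    ∃ u : Fin m → EuclideanSpace ℝ (Fin n), (∀ i, u i ∈ U) ∧ (frameMatrix u).PosDef ∧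
      ∀ u' : Fin m → EuclideanSpace ℝ (Fin n), (∀ i, u' i ∈ U) →
        (frameMatrix u').det ≤ (frameMatrix u).det := by
  obtain ⟨f, hfU, hfspan, -⟩ := Submodule.exists_fun_fin_finrank_span_eq ℝ U
  have hcard : Module.finrank ℝ (Submodule.span ℝ U) = n := by
    rw [hspan]; simp
  set e : Fin n → EuclideanSpace ℝ (Fin n) := f ∘ Fin.cast hcard.symm
  set u₀ : Fin m → EuclideanSpace ℝ (Fin n) :=
    fun j => if h : j.1 < n then e ⟨j, h⟩ else e ⟨0, hn⟩ with hu₀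
  have hu₀U : ∀ j, u₀ j ∈ U := fun j => by
    simp only [hu₀]
    split_ifs <;> exact hfU _
  have hpos₀ : (frameMatrix u₀).PosDef := by
    refine Matrix.PosDef.of_dotProduct_mulVec_pos (posSemidef_frameMatrix u₀).isHermitian
      fun x hx => ?_
    rw [star_trivial, dotProduct_frameMatrix_mulVec]
    refine lt_of_le_of_ne (Finset.sum_nonneg fun i _ => sq_nonneg _) fun h0 => hx ?_
    rw [eq_comm, Finset.sum_eq_zero_iff_of_nonneg fun i _ => sq_nonneg _] at h0
    have horth : ∀ k, ⟪f k, WithLp.toLp 2 x⟫ = 0 := fun k => by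
      have h := h0 ⟨k, (k.2.trans_eq hcard).trans_le hnm⟩ (Finset.mem_univ _)
      rw [sq_eq_zero_iff] at h
      have hk : k.1 < n := k.2.trans_eq hcard
      simp only [hu₀, hk, dite_true] at h
      rw [EuclideanSpace.inner_eq_star_dotProduct, dotProduct_comm]
      simpa [e] using h
    have hmem : (WithLp.toLp 2 x : EuclideanSpace ℝ (Fin n)) ∈
        Submodule.span ℝ (Set.range f) := by rw [hfspan, hspan]; trivial
    have hself : ⟪(WithLp.toLp 2 x : EuclideanSpace ℝ (Fin n)), WithLp.toLp 2 x⟫ = 0 := by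
      refine Submodule.span_induction (p := fun y _ => ⟪y, WithLp.toLp 2 x⟫ = 0) ?_ (by simp)
        (fun a b _ _ ha hb => by rw [inner_add_left, ha, hb, add_zero])
        (fun c a _ ha => by rw [real_inner_smul_left, ha, mul_zero]) hmem
      rintro _ ⟨k, rfl⟩
      exact horth k
    have := inner_self_eq_zero.1 hself
    simpa using this
  have hcont : Continuous fun u : Fin m → EuclideanSpace ℝ (Fin n) => (frameMatrix u).det := by
    refine Continuous.matrix_det ?_
    refine continuous_finsetSum _ fun i _ => ?_
    refine Continuous.matrix_vecMulVec ?_ ?_ <;> fun_prop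
  obtain ⟨u, huU, humax⟩ := (isCompact_univ_pi fun _ : Fin m => hU).exists_isMaxOn
    ⟨u₀, fun j _ => hu₀U j⟩ hcont.continuousOn
  have hmax : ∀ u' : Fin m → EuclideanSpace ℝ (Fin n), (∀ i, u' i ∈ U) →
      (frameMatrix u').det ≤ (frameMatrix u).det := fun u' hu' => humax fun i _ => hu' i
  refine ⟨u, fun i => huU i (Set.mem_univ i), ?_, hmax⟩
  exact (posSemidef_frameMatrix u).posDef_iff_det_ne_zero.2
    (hpos₀.det_pos.trans_le (hmax u₀ hu₀U)).ne'

open scoped Matrix in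
theorem volume_strips_le_of_posDef_frameMatrix {n m : ℕ}
    (u : Fin m → EuclideanSpace ℝ (Fin n)) (hA : (frameMatrix u).PosDef) {ρ : ℝ} (hρ : 0 < ρ)
    (hρu : ∀ i, ρ ≤ (u i).ofLp ⬝ᵥ (frameMatrix u)⁻¹ *ᵥ (u i).ofLp) :
    volume {x : EuclideanSpace ℝ (Fin n) | ∀ i, |⟪u i, x⟫| ≤ 1} ≤
      ENNReal.ofReal ((2 / √ρ) ^ n / √(frameMatrix u).det) := by
  open scoped MatrixOrder in
  obtain ⟨B, hB⟩ := CStarAlgebra.nonneg_iff_eq_star_mul_self.mp hA.posSemidef.nonneg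
  replace hB : frameMatrix u = Bᵀ * B := by simpa [Matrix.star_eq_conjTranspose] using hB
  have hdetB : (frameMatrix u).det = B.det ^ 2 := by
    rw [hB, Matrix.det_mul, Matrix.det_transpose, sq]
  have hB0 : B.det ≠ 0 := fun h => hA.det_pos.ne' (by rw [hdetB, h]; simp)
  have hBu : IsUnit B.det := hB0.isUnit
  set L := Matrix.toEuclideanLin B with hL
  set v : Fin m → EuclideanSpace ℝ (Fin n) := fun i => WithLp.toLp 2 (B⁻¹ᵀ *ᵥ (u i).ofLp) with hv
  have hvinner : ∀ i y, ⟪v i, y⟫ = (u i).ofLp ⬝ᵥ B⁻¹ *ᵥ y.ofLp := fun i y => by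
    rw [EuclideanSpace.inner_eq_star_dotProduct, star_trivial, dotProduct_comm,
      Matrix.dotProduct_mulVec, ← Matrix.mulVec_transpose]
  have hparseval : ∀ y, ∑ i, ⟪v i, y⟫ ^ 2 = ‖y‖ ^ 2 := fun y => by
    simp only [hvinner]
    have hBy : B *ᵥ (B⁻¹ *ᵥ y.ofLp) = y.ofLp := by
      rw [Matrix.mulVec_mulVec, Matrix.mul_nonsing_inv _ hBu, Matrix.one_mulVec]
    rw [← dotProduct_frameMatrix_mulVec, hB, ← Matrix.mulVec_mulVec, hBy,
      Matrix.dotProduct_mulVec, Matrix.vecMul_transpose, hBy, ← real_inner_self_eq_norm_sq,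
      EuclideanSpace.inner_eq_star_dotProduct, star_trivial]
  have hvnorm : ∀ i, ‖v i‖ ^ 2 = (u i).ofLp ⬝ᵥ (frameMatrix u)⁻¹ *ᵥ (u i).ofLp := fun i => by
    rw [← real_inner_self_eq_norm_sq, hvinner, hB, Matrix.mul_inv_rev,
      ← Matrix.transpose_nonsing_inv B, ← Matrix.mulVec_mulVec]
  have hpre : {x : EuclideanSpace ℝ (Fin n) | ∀ i, |⟪u i, x⟫| ≤ 1} =
      L ⁻¹' {y | ∀ i, |⟪v i, y⟫| ≤ 1} := by
    ext x
    have : ∀ i, ⟪v i, L x⟫ = ⟪u i, x⟫ := fun i => by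
      rw [hvinner, hL, Matrix.ofLp_toLpLin, Matrix.toLin'_apply, Matrix.mulVec_mulVec,
        Matrix.nonsing_inv_mul _ hBu, Matrix.one_mulVec,
        EuclideanSpace.inner_eq_star_dotProduct, star_trivial, dotProduct_comm]
    simp [this]
  have hdetL : LinearMap.det L = B.det := by
    rw [hL, Matrix.toEuclideanLin_eq_toLin_orthonormal, LinearMap.det_toLin]
  rw [hpre, Measure.addHaar_preimage_linearMap _ (by rwa [hdetL]), hdetL, hdetB,
    Real.sqrt_sq_eq_abs, abs_inv, div_eq_inv_mul, ENNReal.ofReal_mul (by positivity)]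
  gcongr
  exact volume_strips_le_of_parseval v hparseval hρ fun i => by rw [hvnorm]; exact hρu i

open scoped Matrix in
theorem exists_frame_volume_strips_le {n m : ℕ} (hn : 1 ≤ n) (hnm : n ≤ m)
    {U : Set (EuclideanSpace ℝ (Fin n))} (hU : IsCompact U)
    (hUtrace : ∀ Q : Matrix (Fin n) (Fin n) ℝ, ∃ v ∈ U, Q.trace ≤ n * (v.ofLp ⬝ᵥ Q *ᵥ v.ofLp)) :
    ∃ u : Fin m → EuclideanSpace ℝ (Fin n), (∀ i, u i ∈ U) ∧
      volume {x : EuclideanSpace ℝ (Fin n) | ∀ i, |⟪u i, x⟫| ≤ 1} ≤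
        ENNReal.ofReal ((2 * √((m + 1) / (m + 1 - n))) ^ n) := by
  have hn0 : (0 : ℝ) < n := by exact_mod_cast hn
  have hnm' : (n : ℝ) ≤ m := by exact_mod_cast hnm
  have hspan : Submodule.span ℝ U = ⊤ := by
    rw [← Submodule.orthogonal_eq_bot_iff, Submodule.eq_bot_iff]
    intro x hx
    obtain ⟨v, hvU, hv⟩ := hUtrace (Matrix.vecMulVec x.ofLp x.ofLp)
    have hxv : v.ofLp ⬝ᵥ x.ofLp = 0 := by
      have h := (Submodule.mem_orthogonal' _ _).1 hx v (Submodule.subset_span hvU)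
      rwa [EuclideanSpace.inner_eq_star_dotProduct, star_trivial] at h
    rw [Matrix.trace_vecMulVec, Matrix.vecMulVec_mulVec, dotProduct_comm x.ofLp v.ofLp, hxv] at hv
    have h0 : ‖x‖ ^ 2 ≤ 0 := by
      rw [← real_inner_self_eq_norm_sq, EuclideanSpace.inner_eq_star_dotProduct, star_trivial]
      simpa using hv
    exact norm_eq_zero.1 (sq_eq_zero_iff.1 (le_antisymm h0 (sq_nonneg _)))
  obtain ⟨u, huU, hA, hmax⟩ := exists_frame_maximizing_det hn hnm hU hspan
  refine ⟨u, huU, ?_⟩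
  set A := frameMatrix u with hAdef
  have hAu : IsUnit A.det := hA.det_pos.ne'.isUnit
  have hAsym : A⁻¹ᵀ = A⁻¹ := by simpa using hA.inv.isHermitian.eq
  set t : Fin m → ℝ := fun i => (u i).ofLp ⬝ᵥ A⁻¹ *ᵥ (u i).ofLp with ht
  set τ := A⁻¹.trace / n with hτ
  have hτpos : 0 < τ := by
    have : Nonempty (Fin n) := ⟨⟨0, hn⟩⟩
    exact div_pos hA.inv.trace_pos hn0
  have htr : A⁻¹.trace = n * τ := by rw [hτ]; field_simp
  set q : Fin m → ℝ := fun i => (A⁻¹ *ᵥ (u i).ofLp) ⬝ᵥ (A⁻¹ *ᵥ (u i).ofLp) with hq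
  have hq0 : ∀ i, 0 ≤ q i := fun i => by
    simpa using dotProduct_star_self_nonneg (A⁻¹ *ᵥ (u i).ofLp)
  have hswap : ∀ i, (1 - t i) * (n * τ) + q i ≤ n * t i := fun i => by
    obtain ⟨v, hvU, hv⟩ := hUtrace ((1 - t i) • A⁻¹ +
      Matrix.vecMulVec (A⁻¹ *ᵥ (u i).ofLp) (A⁻¹ *ᵥ (u i).ofLp))
    have hdet := hmax (Function.update u i v) fun j => by
      rcases eq_or_ne j i with rfl | hj
      · rwa [Function.update_self]
      · rw [Function.update_of_ne hj]; exact huU j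
    rw [frameMatrix_update, Matrix.det_sub_vecMulVec_add_vecMulVec hA,
      mul_le_iff_le_one_right hA.det_pos] at hdet
    have hsym : (A⁻¹ *ᵥ (u i).ofLp) ⬝ᵥ v.ofLp = (u i).ofLp ⬝ᵥ A⁻¹ *ᵥ v.ofLp := by
      rw [Matrix.dotProduct_mulVec, ← Matrix.mulVec_transpose, hAsym]
    rw [Matrix.trace_add, Matrix.trace_smul, Matrix.trace_vecMulVec, Matrix.add_mulVec,
      dotProduct_add, Matrix.smul_mulVec, dotProduct_smul, Matrix.vecMulVec_mulVec, htr,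
      hsym] at hv
    simp only [smul_eq_mul, op_smul_eq_smul, dotProduct_smul] at hv
    rw [dotProduct_comm v.ofLp (A⁻¹ *ᵥ (u i).ofLp), hsym] at hv
    refine hv.trans (mul_le_mul_of_nonneg_left ?_ hn0.le)
    simp only [ht]
    linarith
  have hsumt : ∑ i, t i = n := by
    rw [← trace_mul_frameMatrix, Matrix.nonsing_inv_mul _ hAu]
    simp
  have hsumq : ∑ i, q i = n * τ := by
    have h := trace_mul_frameMatrix u (A⁻¹ * A⁻¹)
    rw [Matrix.mul_assoc, Matrix.nonsing_inv_mul _ hAu, Matrix.mul_one, htr] at h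
    rw [h]
    refine Finset.sum_congr rfl fun i _ => ?_
    rw [← Matrix.mulVec_mulVec, Matrix.dotProduct_mulVec _ A⁻¹, ← Matrix.mulVec_transpose, hAsym]
  have hτle : τ * (m + 1 - n) ≤ n := by
    have h := Finset.sum_le_sum fun i (_ : i ∈ Finset.univ) => hswap i
    rw [Finset.sum_add_distrib, ← Finset.sum_mul, Finset.sum_sub_distrib, ← Finset.mul_sum,
      hsumt, hsumq] at h
    simp only [Finset.sum_const, Finset.card_univ, Fintype.card_fin, nsmul_eq_mul, mul_one] at h
    refine le_of_mul_le_mul_left ?_ hn0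
    linarith
  have hlow : ∀ i, τ / (1 + τ) ≤ t i := fun i => by
    rw [div_le_iff₀ (by linarith)]
    refine le_of_mul_le_mul_left ?_ hn0
    have := hswap i
    have := hq0 i
    linarith
  refine (volume_strips_le_of_posDef_frameMatrix u hA (by positivity) hlow).trans
    (ENNReal.ofReal_le_ofReal ?_)
  have hdetinv : (A.det)⁻¹ ≤ τ ^ n := by
    have h := Matrix.PosDef.det_le_trace_div_pow hn hA.inv
    rwa [Matrix.det_nonsing_inv, Ring.inverse_eq_inv'] at h
  have hsqrt : (√A.det)⁻¹ ≤ √τ ^ n := by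
    rw [← Real.sqrt_inv]
    refine Real.sqrt_le_iff.2 ⟨by positivity, ?_⟩
    rwa [← pow_mul, mul_comm, pow_mul, Real.sq_sqrt hτpos.le]
  have hk : (0 : ℝ) < m + 1 - n := by linarith
  calc (2 / √(τ / (1 + τ))) ^ n / √A.det
      ≤ (2 / √(τ / (1 + τ))) ^ n * √τ ^ n := by
        rw [div_eq_mul_inv]; gcongr
    _ = (2 * √(1 + τ)) ^ n := by
        rw [← mul_pow, Real.sqrt_div hτpos.le]
        have := (Real.sqrt_pos.2 hτpos).ne'
        congr 1
        field_simp
    _ ≤ _ := by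
        gcongr
        rw [le_div_iff₀ hk]
        linarith

theorem isCompact_unit_contact {n : ℕ} (K : Set (EuclideanSpace ℝ (Fin n))) :
    IsCompact {u : EuclideanSpace ℝ (Fin n) | ‖u‖ = 1 ∧ ∀ x ∈ K, |⟪x, u⟫| ≤ 1} := by
  have : {u : EuclideanSpace ℝ (Fin n) | ‖u‖ = 1 ∧ ∀ x ∈ K, |⟪x, u⟫| ≤ 1} =
      Metric.sphere 0 1 ∩ ⋂ x ∈ K, {u | |⟪x, u⟫| ≤ 1} := by
    ext; simp
  rw [this]
  exact (isCompact_sphere _ _).inter_right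
    (isClosed_biInter fun x _ => isClosed_le (by fun_prop) continuous_const)

/-- If `K` is a symmetric convex body in `ℝⁿ` in John's position (the unit ball is contained
in `K` and every affine image of the unit ball contained in `K` has volume at most that of
the unit ball), then for every `d > 1` there are `s ≤ dn` unit vectors `w₁, …, w_s` such that
`K ⊆ P := ⋂ⱼ {x : |⟪x, wⱼ⟫| ≤ 1}` and `|P|^{1/n} ≤ 2(√d + 1)/(√d − 1)`, i.e.
`|P| ≤ (2(√d + 1)/(√d − 1))ⁿ`. -/
theorem symmetric_john_position_few_strips (n : ℕ) (hn : 1 ≤ n)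
    (K : Set (EuclideanSpace ℝ (Fin n)))
    (hKcompact : IsCompact K) (hKconv : Convex ℝ K)
    (hKint : (interior K).Nonempty)
    (hKsymm : ∀ x ∈ K, -x ∈ K)
    (hKball : Metric.closedBall (0 : EuclideanSpace ℝ (Fin n)) 1 ⊆ K)
    (hKjohn : ∀ (T : EuclideanSpace ℝ (Fin n) ≃ₗ[ℝ] EuclideanSpace ℝ (Fin n))
      (a : EuclideanSpace ℝ (Fin n)),
      (fun x => T x + a) '' Metric.closedBall (0 : EuclideanSpace ℝ (Fin n)) 1 ⊆ K →
      volume ((fun x => T x + a) '' Metric.closedBall (0 : EuclideanSpace ℝ (Fin n)) 1) ≤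
        volume (Metric.closedBall (0 : EuclideanSpace ℝ (Fin n)) 1))
    (d : ℝ) (hd : 1 < d) :
    ∃ (s : ℕ) (w : Fin s → EuclideanSpace ℝ (Fin n)), (s : ℝ) ≤ d * n ∧
      (∀ j, ‖w j‖ = 1) ∧
      K ⊆ ⋂ j, {x : EuclideanSpace ℝ (Fin n) | |⟪x, w j⟫| ≤ 1} ∧
      volume (⋂ j, {x : EuclideanSpace ℝ (Fin n) | |⟪x, w j⟫| ≤ 1}) ≤
        ENNReal.ofReal ((2 * (Real.sqrt d + 1) / (Real.sqrt d - 1)) ^ n) := by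
  set U := {u : EuclideanSpace ℝ (Fin n) | ‖u‖ = 1 ∧ ∀ x ∈ K, |⟪x, u⟫| ≤ 1}
  have hn0 : (0 : ℝ) < n := by exact_mod_cast hn
  have hnm : n ≤ ⌊d * n⌋₊ := Nat.le_floor (by nlinarith)
  obtain ⟨u, huU, hvol⟩ := exists_frame_volume_strips_le hn hnm (isCompact_unit_contact K)
    fun Q => by
      obtain ⟨v, hv1, hv2, hv3⟩ := exists_contact_trace_le hn hKcompact hKconv hKsymm hKball
        (fun T hT => by simpa using hKjohn T 0 (by simpa using hT)) Q
      exact ⟨v, ⟨hv1, hv2⟩, hv3⟩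
  refine ⟨⌊d * n⌋₊, u, Nat.floor_le (by positivity), fun j => (huU j).1,
    fun x hx => Set.mem_iInter.2 fun j => (huU j).2 x hx, ?_⟩
  have hset : ⋂ j, {x : EuclideanSpace ℝ (Fin n) | |⟪x, u j⟫| ≤ 1} =
      {x | ∀ i, |⟪u i, x⟫| ≤ 1} := by
    ext x
    simp [real_inner_comm x]
  rw [hset]
  refine hvol.trans (ENNReal.ofReal_le_ofReal ?_)
  have hfloor := Nat.lt_floor_add_one (d * n)
  set k : ℝ := (⌊d * n⌋₊ : ℝ) + 1
  have hk : 0 < k - n := by nlinarith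
  set q := √d with hq
  have hqd : q ^ 2 = d := Real.sq_sqrt (by linarith)
  have hq1 : 1 < q := by rw [hq]; exact Real.lt_sqrt_of_sq_lt (by linarith)
  have h1 : k / (k - n) ≤ ((q + 1) / (q - 1)) ^ 2 := by
    calc k / (k - n) ≤ d / (d - 1) := by
          rw [div_le_div_iff₀ hk (by linarith)]
          linarith
      _ ≤ ((q + 1) / (q - 1)) ^ 2 := by
          rw [← hqd, div_pow, div_le_div_iff₀ (by nlinarith) (by nlinarith)]
          have h3 : q ^ 2 * (q - 1) ≤ (q + 1) ^ 3 := by nlinarith [sq_nonneg q]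
          nlinarith
  have h2 : √(k / (k - n)) ≤ (q + 1) / (q - 1) :=
    Real.sqrt_le_iff.2 ⟨div_nonneg (by linarith) (by linarith), h1⟩
  rw [mul_div_assoc]
  gcongr
end

section
/- Let 0 < ε ≤ 1, let u_1, …, u_s be unit vectors in ℝⁿ, c_1, …, c_s > 0, and u ∈ ℝⁿ satisfy I_n ⪯ Σ_{j=1}^s c_j (u_j + u) ⊗ (u_j + u) ⪯ (4 + ε) I_n, Σ_{j=1}^s c_j (u_j + u) = 0, and ‖u‖² ≤ ε / (Σ_{j=1}^s c_j). Define vectors in ℝ^{n+1} by v_j = √(n/(n+1)) · (−u_j, 1/√n) and v = −√(n/(n+1)) · (u, 0), and set b_j = ((n+1)/n) c_j. Then I_{n+1} ⪯ Σ_{j=1}^s b_j (v_j + v) ⊗ (v_j + v) ⪯ (4 + 2ε) I_{n+1}. -/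
open scoped Matrix

theorem dotProduct_sum_smul_vecMulVec_mulVec {ι m : Type*} [Fintype ι] [Fintype m]
    (c : ι → ℝ) (a : ι → m → ℝ) (x : m → ℝ) :
    x ⬝ᵥ (∑ j, c j • Matrix.vecMulVec (a j) (a j)).mulVec x = ∑ j, c j * (a j ⬝ᵥ x) ^ 2 := by
  rw [Matrix.sum_mulVec, dotProduct_sum]
  refine Finset.sum_congr rfl fun j _ => ?_
  rw [Matrix.smul_mulVec, Matrix.vecMulVec_mulVec, dotProduct_smul, op_smul_eq_smul,
    dotProduct_smul, dotProduct_comm x, smul_eq_mul, smul_eq_mul]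
  ring

theorem sum_dotProduct_single_sq {ι m : Type*} [Fintype ι] [Fintype m] [DecidableEq m]
    (c : ι → ℝ) (a : ι → m → ℝ) :
    ∑ i, ∑ j, c j * (a j ⬝ᵥ Pi.single i 1) ^ 2 = ∑ j, c j * (a j ⬝ᵥ a j) := by
  rw [Finset.sum_comm]
  refine Finset.sum_congr rfl fun j _ => ?_
  simp only [dotProduct_single_one, ← Finset.mul_sum]
  simp only [dotProduct, sq]

/-- If the weighted barycentre of the translates `uⱼ + w` of unit vectors vanishes, then
`∑ cⱼ ‖uⱼ + w‖² = (∑ cⱼ) (1 - ‖w‖²)`. -/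
theorem sum_mul_dotProduct_add_self {ι m : Type*} [Fintype ι] [Fintype m]
    {c : ι → ℝ} {u : ι → m → ℝ} {w : m → ℝ} (hu : ∀ j, u j ⬝ᵥ u j = 1)
    (h : ∑ j, c j • (u j + w) = 0) :
    ∑ j, c j * ((u j + w) ⬝ᵥ (u j + w)) = (∑ j, c j) * (1 - w ⬝ᵥ w) := by
  have h0 : ∑ j, c j * ((u j + w) ⬝ᵥ w) = 0 := by
    simpa only [sum_dotProduct, smul_dotProduct, smul_eq_mul, zero_dotProduct] using
      congrArg (· ⬝ᵥ w) h
  have key : ∀ j, c j * ((u j + w) ⬝ᵥ (u j + w)) =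
      c j * (1 - w ⬝ᵥ w) + 2 * (c j * ((u j + w) ⬝ᵥ w)) := fun j => by
    simp only [add_dotProduct, dotProduct_add, hu, dotProduct_comm w (u j)]
    ring
  simp only [key, Finset.sum_add_distrib, ← Finset.mul_sum, h0, ← Finset.sum_mul]
  ring

theorem snoc_dotProduct {n : ℕ} (x : Fin n → ℝ) (t : ℝ) (y : Fin (n + 1) → ℝ) :
    (Fin.snoc x t : Fin (n + 1) → ℝ) ⬝ᵥ y = x ⬝ᵥ Fin.init y + t * y (Fin.last n) := by
  simp [dotProduct, Fin.sum_univ_castSucc, Fin.init]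

/-- Lifting an approximate John decomposition to `ℝ^{n+1}`: with the hypotheses of
Srivastava's theorem in `ℝⁿ`, the vectors `vⱼ = √(n/(n+1)) ((−uⱼ), 1/√n)` and
`v = −√(n/(n+1)) (u, 0)` in `ℝ^{n+1}`, together with weights `bⱼ = ((n+1)/n) cⱼ`, satisfy
`I_{n+1} ⪯ Σ bⱼ (vⱼ + v) ⊗ (vⱼ + v) ⪯ (4 + 2ε) I_{n+1}`. -/
theorem lifted_decomposition_bounds (n s : ℕ) (hn : 0 < n)
    (ε : ℝ) (hε : 0 < ε) (hε1 : ε ≤ 1)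
    (u : Fin s → Fin n → ℝ) (hu : ∀ j, u j ⬝ᵥ u j = 1)
    (c : Fin s → ℝ) (hc : ∀ j, 0 < c j) (w : Fin n → ℝ)
    (h1 : ∀ x : Fin n → ℝ,
      x ⬝ᵥ x ≤ x ⬝ᵥ (∑ j, c j • Matrix.vecMulVec (u j + w) (u j + w)).mulVec x)
    (h2 : ∀ x : Fin n → ℝ,
      x ⬝ᵥ (∑ j, c j • Matrix.vecMulVec (u j + w) (u j + w)).mulVec x ≤ (4 + ε) * (x ⬝ᵥ x))
    (h3 : ∑ j, c j • (u j + w) = 0)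
    (h4 : w ⬝ᵥ w ≤ ε / ∑ j, c j)
    (v : Fin s → Fin (n + 1) → ℝ)
    (hv : ∀ j, v j = Real.sqrt ((n : ℝ) / (n + 1)) • (Fin.snoc (-(u j)) (1 / Real.sqrt n) : Fin (n + 1) → ℝ))
    (v0 : Fin (n + 1) → ℝ)
    (hv0 : v0 = -(Real.sqrt ((n : ℝ) / (n + 1)) • (Fin.snoc w 0 : Fin (n + 1) → ℝ)))
    (b : Fin s → ℝ) (hb : ∀ j, b j = (((n : ℝ) + 1) / n) * c j) :
    (∀ y : Fin (n + 1) → ℝ,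
      y ⬝ᵥ y ≤ y ⬝ᵥ (∑ j, b j • Matrix.vecMulVec (v j + v0) (v j + v0)).mulVec y) ∧
    (∀ y : Fin (n + 1) → ℝ,
      y ⬝ᵥ (∑ j, b j • Matrix.vecMulVec (v j + v0) (v j + v0)).mulVec y ≤
        (4 + 2 * ε) * (y ⬝ᵥ y)) := by
  have hn0 : (0 : ℝ) < n := Nat.cast_pos.mpr hn
  have hn1 : (1 : ℝ) ≤ n := Nat.one_le_cast.mpr hn
  have hC : 0 ≤ ∑ j, c j := Finset.sum_nonneg fun j _ => (hc j).le
  have hw : 0 ≤ w ⬝ᵥ w := Finset.sum_nonneg fun i _ => mul_self_nonneg (w i)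
  have hCw : (∑ j, c j) * (w ⬝ᵥ w) ≤ ε := by
    rcases hC.eq_or_lt with h | h
    · rw [← h, zero_mul]
      exact hε.le
    · rw [mul_comm]
      exact (le_div_iff₀ h).mp h4
  simp only [dotProduct_sum_smul_vecMulVec_mulVec] at h1 h2 ⊢
  have htr := (sum_dotProduct_single_sq c fun j => u j + w).trans
    (sum_mul_dotProduct_add_self hu h3)
  have hlow : (n : ℝ) ≤ (∑ j, c j) * (1 - w ⬝ᵥ w) := by
    rw [← htr]
    simpa using Finset.sum_le_sum fun i (_ : i ∈ Finset.univ) => h1 (Pi.single i 1)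
  have hupp : (∑ j, c j) * (1 - w ⬝ᵥ w) ≤ n * (4 + ε) := by
    rw [← htr]
    simpa [mul_add] using Finset.sum_le_sum fun i (_ : i ∈ Finset.univ) => h2 (Pi.single i 1)
  have hlow' : 1 ≤ (∑ j, c j) / n := by
    rw [le_div_iff₀ hn0]
    nlinarith
  have hupp' : (∑ j, c j) / n ≤ 4 + 2 * ε := by
    rw [div_le_iff₀ hn0]
    nlinarith
  have hquad : ∀ y : Fin (n + 1) → ℝ, ∑ j, b j * ((v j + v0) ⬝ᵥ y) ^ 2 =
      ∑ j, c j * ((u j + w) ⬝ᵥ Fin.init y) ^ 2 + (∑ j, c j) / n * y (Fin.last n) ^ 2 := by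
    intro y
    have h0 : ∑ j, c j * ((u j + w) ⬝ᵥ Fin.init y) = 0 := by
      simpa only [sum_dotProduct, smul_dotProduct, smul_eq_mul, zero_dotProduct] using
        congrArg (· ⬝ᵥ Fin.init y) h3
    have key : ∀ j, b j * ((v j + v0) ⬝ᵥ y) ^ 2 = c j * ((u j + w) ⬝ᵥ Fin.init y) ^ 2 +
        c j * (y (Fin.last n) ^ 2 / n) -
        2 * (y (Fin.last n) / √n) * (c j * ((u j + w) ⬝ᵥ Fin.init y)) := fun j => by
      have hv' : (v j + v0) ⬝ᵥ y =
          √(n / (n + 1)) * (y (Fin.last n) / √n - (u j + w) ⬝ᵥ Fin.init y) := by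
        rw [hv, hv0, add_dotProduct, neg_dotProduct, smul_dotProduct, smul_dotProduct,
          snoc_dotProduct, snoc_dotProduct, add_dotProduct, neg_dotProduct, smul_eq_mul,
          smul_eq_mul]
        ring
      have hb' : b j * √(n / (n + 1)) ^ 2 = c j := by
        rw [hb, Real.sq_sqrt (by positivity)]
        field_simp
      rw [hv', mul_pow, ← mul_assoc, hb', sub_sq, div_pow, Real.sq_sqrt hn0.le]
      ring
    simp only [key, Finset.sum_add_distrib, Finset.sum_sub_distrib, ← Finset.mul_sum, h0,
      ← Finset.sum_mul]
    ring
  have hnorm : ∀ y : Fin (n + 1) → ℝ,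
      y ⬝ᵥ y = Fin.init y ⬝ᵥ Fin.init y + y (Fin.last n) ^ 2 := fun y => by
    simp [dotProduct, Fin.sum_univ_castSucc, Fin.init, sq]
  refine ⟨fun y => ?_, fun y => ?_⟩
  · rw [hquad, hnorm]
    exact add_le_add (h1 _) (le_mul_of_one_le_left (sq_nonneg _) hlow')
  · have hy : 0 ≤ Fin.init y ⬝ᵥ Fin.init y :=
      Finset.sum_nonneg fun i _ => mul_self_nonneg (Fin.init (α := fun _ => ℝ) y i)
    rw [hquad, hnorm, mul_add]
    refine add_le_add ((h2 _).trans ?_) (mul_le_mul_of_nonneg_right hupp' (sq_nonneg _))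
    exact mul_le_mul_of_nonneg_right (by linarith) hy
end
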